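/- arXiv:2108.11972 — 7 statements merged into one kernel-verified Lean document; each statement's English description precedes it below -/
import Mathlib

section
/- Let η, δ, ε be positive real numbers with η·δ < π/2. Then there exists a C^∞ function p : ℝ → ℝ which is nondecreasing and satisfies: 0 ≤ p(t) ≤ η·tan(η·δ) for all t ∈ ℝ; p(t) = 0 for all t ≤ 0; p(t) = η·tan(η·δ) for all t ≥ δ + ε; and deriv p t ≤ η² + p(t)² for every t ∈ ℝ. -/
/-- A smooth monotone step from `0` to `δ` across `[0, δ + ε]` with slope at most `1`. -/
theorem exists_smooth_step_deriv_le_one {δ ε : ℝ} (hδ : 0 < δ) (hε : 0 < ε) :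
    ∃ s : ℝ → ℝ, ContDiff ℝ (⊤ : ℕ∞) s ∧ Monotone s ∧ (∀ t, t ≤ 0 → s t = 0) ∧
      (∀ t, δ + ε ≤ t → s t = δ) ∧ ∀ t, deriv s t ≤ 1 := by
  let f : ContDiffBump ((δ + ε) / 2) := ⟨δ / 2, (δ + ε) / 2, by linarith, by linarith⟩
  have hout : ∀ t, t ≤ 0 ∨ δ + ε ≤ t → f t = 0 := by
    intro t ht
    apply f.zero_of_le_dist
    change (δ + ε) / 2 ≤ dist t ((δ + ε) / 2)
    rw [Real.dist_eq, le_abs]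
    rcases ht with ht | ht
    · right; linarith
    · left; linarith
  set I := ∫ x in (0 : ℝ)..(δ + ε), f x with hI
  have hδI : δ ≤ I := by
    have h1 := f.measure_closedBall_le_integral MeasureTheory.volume
    have h2 : ∫ x in (0 : ℝ)..(δ + ε), f x = ∫ x, f x := by
      apply intervalIntegral.integral_eq_integral_of_support_subset
      intro x hx
      by_contra h
      rw [Set.mem_Ioc, not_and_or, not_lt, not_le] at h
      exact hx (hout x (h.imp id le_of_lt))
    have h3 : MeasureTheory.volume.real (Metric.closedBall ((δ + ε) / 2) f.rIn) = δ := by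
      rw [Real.volume_real_closedBall f.rIn_pos.le]
      change 2 * (δ / 2) = δ
      ring
    exact h3.symm.le.trans (h1.trans h2.symm.le)
  have hIpos : 0 < I := hδ.trans_le hδI
  have hderiv : ∀ t, HasDerivAt (fun t => δ / I * ∫ x in (0 : ℝ)..t, f x) (δ / I * f t) t :=
    fun t => (f.continuous.integral_hasStrictDerivAt 0 t).hasDerivAt.const_mul _
  have hderiv_eq : deriv (fun t => δ / I * ∫ x in (0 : ℝ)..t, f x) = fun t => δ / I * f t :=
    funext fun t => (hderiv t).deriv
  refine ⟨fun t => δ / I * ∫ x in (0 : ℝ)..t, f x, ?_, ?_, ?_, ?_, ?_⟩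
  · rw [contDiff_infty_iff_deriv, hderiv_eq]
    exact ⟨fun t => (hderiv t).differentiableAt, contDiff_const.mul f.contDiff⟩
  · refine monotone_of_deriv_nonneg (fun t => (hderiv t).differentiableAt) fun t => ?_
    rw [hderiv_eq]
    exact mul_nonneg (by positivity) f.nonneg
  · intro t ht
    have h : ∫ x in (0 : ℝ)..t, f x = 0 := by
      rw [intervalIntegral.integral_congr (g := fun _ => (0 : ℝ)), intervalIntegral.integral_zero]
      intro x hx
      rw [Set.uIcc_of_ge ht] at hx
      exact hout x (.inl hx.2)
    simp only [h, mul_zero]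
  · intro t ht
    have h : ∫ x in (δ + ε)..t, f x = 0 := by
      rw [intervalIntegral.integral_congr (g := fun _ => (0 : ℝ)), intervalIntegral.integral_zero]
      intro x hx
      rw [Set.uIcc_of_le ht] at hx
      exact hout x (.inr hx.1)
    change δ / I * ∫ x in (0 : ℝ)..t, f x = δ
    rw [← intervalIntegral.integral_add_adjacent_intervals
      (f.continuous.intervalIntegrable 0 (δ + ε)) (f.continuous.intervalIntegrable (δ + ε) t),
      h, add_zero, ← hI, div_mul_cancel₀ _ hIpos.ne']
  · intro t
    rw [hderiv_eq]
    exact mul_le_one₀ ((div_le_one hIpos).2 hδI) f.nonneg f.le_one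


/-- One-dimensional model of Lemma 3.2 (tangent growth potential):
given `η, δ, ε > 0` with `η·δ < π/2`, there is a smooth nondecreasing
function `p : ℝ → ℝ` with `0 ≤ p ≤ η·tan(η·δ)`, `p = 0` on `(-∞, 0]`,
`p = η·tan(η·δ)` on `[δ+ε, ∞)`, and `p' ≤ η² + p²` everywhere. -/
theorem tangent_growth_one_dim (η δ ε : ℝ) (hη : 0 < η) (hδ : 0 < δ) (hε : 0 < ε)
    (hηδ : η * δ < Real.pi / 2) :
    ∃ p : ℝ → ℝ, ContDiff ℝ (⊤ : ℕ∞) p ∧ Monotone p ∧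
      (∀ t : ℝ, 0 ≤ p t ∧ p t ≤ η * Real.tan (η * δ)) ∧
      (∀ t : ℝ, t ≤ 0 → p t = 0) ∧
      (∀ t : ℝ, δ + ε ≤ t → p t = η * Real.tan (η * δ)) ∧
      (∀ t : ℝ, deriv p t ≤ η ^ 2 + (p t) ^ 2) := by
  obtain ⟨s, hs, hmono, hzero, hend, hslope⟩ := exists_smooth_step_deriv_le_one hδ hε
  have hs0 : ∀ t, 0 ≤ s t := fun t =>
    (hzero _ (min_le_right t 0)).symm.le.trans (hmono (min_le_left t 0))
  have hsδ : ∀ t, s t ≤ δ := fun t =>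
    (hmono (le_max_left t (δ + ε))).trans (hend _ (le_max_right t (δ + ε))).le
  have hmem : ∀ t, η * s t ∈ Set.Ioo (-(Real.pi / 2)) (Real.pi / 2) := fun t =>
    ⟨by linarith [Real.pi_pos, mul_nonneg hη.le (hs0 t)],
      (mul_le_mul_of_nonneg_left (hsδ t) hη.le).trans_lt hηδ⟩
  have hcos : ∀ t, Real.cos (η * s t) ≠ 0 := fun t => (Real.cos_pos_of_mem_Ioo (hmem t)).ne'
  have hp : Monotone fun t => η * Real.tan (η * s t) := fun a b hab =>
    mul_le_mul_of_nonneg_left (Real.strictMonoOn_tan.monotoneOn (hmem a) (hmem b)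
      (mul_le_mul_of_nonneg_left (hmono hab) hη.le)) hη.le
  have hp0 : ∀ t, t ≤ 0 → η * Real.tan (η * s t) = 0 := fun t ht => by simp [hzero t ht]
  have hpδ : ∀ t, δ + ε ≤ t → η * Real.tan (η * s t) = η * Real.tan (η * δ) :=
    fun t ht => by rw [hend t ht]
  refine ⟨fun t => η * Real.tan (η * s t), ?_, hp, fun t => ⟨?_, ?_⟩, hp0, hpδ, fun t => ?_⟩
  · exact contDiff_const.mul (contDiff_iff_contDiffAt.2 fun t =>
      ContDiffAt.comp (g := Real.tan) (f := fun t => η * s t) t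
        (Real.contDiffAt_tan.2 (hcos t)) (contDiff_const.mul hs).contDiffAt)
  · exact (hp0 _ (min_le_right t 0)).symm.le.trans (hp (min_le_left t 0))
  · exact (hp (le_max_left t (δ + ε))).trans (hpδ _ (le_max_right t (δ + ε))).le
  · have hsd : HasDerivAt s (deriv s t) t :=
      (hs.differentiable (by simp) t).hasDerivAt
    have hd := ((Real.hasDerivAt_tan (hcos t)).comp t (hsd.const_mul η)).const_mul η
    rw [show deriv (fun t => η * Real.tan (η * s t)) t = _ from hd.deriv,
      one_div, ← Real.inv_one_add_tan_sq (hcos t), inv_inv]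
    calc η * ((1 + Real.tan (η * s t) ^ 2) * (η * deriv s t))
        = (η ^ 2 * (1 + Real.tan (η * s t) ^ 2)) * deriv s t := by ring
      _ ≤ (η ^ 2 * (1 + Real.tan (η * s t) ^ 2)) * 1 :=
        mul_le_mul_of_nonneg_left (hslope t) (by positivity)
      _ = η ^ 2 + (η * Real.tan (η * s t)) ^ 2 := by ring
end

section
/- Let λ > 0, let δ be a real number with 0 < δ < 1/λ, and let ε > 0. Then there exists a C^∞ function h : ℝ → ℝ which is nondecreasing and satisfies: λ ≤ h(t) ≤ λ/(1 − δ·λ) for all t ∈ ℝ; h(t) = λ for all t ≤ 0; h(t) = λ/(1 − δ·λ) for all t ≥ δ + ε; and 0 ≤ deriv h t ≤ h(t)² for every t ∈ ℝ. -/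
/-- A smooth transition from `0` on `(-∞, 0]` to `a` on `[b, ∞)`, with slope in `[0, 1]`, exists
as soon as `0 < a < b`. -/
theorem exists_contDiff_transition_deriv_le_one {a b : ℝ} (ha : 0 < a) (hab : a < b) :
    ∃ φ : ℝ → ℝ, ContDiff ℝ (⊤ : ℕ∞) φ ∧ (∀ t, 0 ≤ deriv φ t ∧ deriv φ t ≤ 1) ∧
      (∀ t ≤ 0, φ t = 0) ∧ ∀ t, b ≤ t → φ t = a := by
  let f : ContDiffBump (b / 2) := ⟨a / 2, b / 2, by linarith, by linarith⟩
  let g : ℝ → ℝ := f.normed MeasureTheory.volume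
  have hg : ContDiff ℝ (⊤ : ℕ∞) g := f.contDiff_normed
  have hsupp : Function.support g = Set.Ioo 0 b := by
    simp only [g, f, f.support_normed_eq, Real.ball_eq_Ioo, sub_self, add_halves]
  have hderiv (t : ℝ) : HasDerivAt (fun t => a * ∫ x in (0 : ℝ)..t, g x) (a * g t) t :=
    (hg.continuous.integral_hasStrictDerivAt 0 t).hasDerivAt.const_mul a
  refine ⟨fun t => a * ∫ x in (0 : ℝ)..t, g x, ?_, fun t => ?_, fun t ht => ?_, fun t ht => ?_⟩
  · refine contDiff_infty_iff_deriv.2 ⟨fun t => (hderiv t).differentiableAt, ?_⟩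
    rw [funext fun t => (hderiv t).deriv]
    exact contDiff_const.mul hg
  · rw [(hderiv t).deriv]
    refine ⟨mul_nonneg ha.le (f.nonneg_normed t), ?_⟩
    have hle : g t ≤ 1 / a := by
      have h := f.normed_le_div_measure_closedBall_rIn MeasureTheory.volume t
      rwa [Real.volume_real_closedBall f.rIn_pos.le, mul_div_cancel₀ a two_ne_zero] at h
    calc a * g t ≤ a * (1 / a) := by gcongr
      _ = 1 := mul_one_div_cancel ha.ne'
  · have hzero : Set.EqOn g (fun _ => 0) (Set.uIcc 0 t) := fun x hx => by
      rw [Set.uIcc_of_ge ht] at hx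
      refine Function.notMem_support.1 fun h => ?_
      rw [hsupp] at h
      exact h.1.not_ge hx.2
    simp [intervalIntegral.integral_congr hzero]
  · have hone : ∫ x in (0 : ℝ)..t, g x = 1 := by
      rw [intervalIntegral.integral_eq_integral_of_support_subset]
      · exact f.integral_normed
      · rw [hsupp]
        exact fun x hx => ⟨hx.1, hx.2.le.trans ht⟩
    simp [hone]

/-- One-dimensional model of Lemma 3.3 (escape-to-infinity potential):
given `λ > 0`, `0 < δ < 1/λ` and `ε > 0`, there is a smooth nondecreasing
function `h : ℝ → ℝ` with `λ ≤ h ≤ λ/(1 − δλ)`, `h = λ` on `(-∞, 0]`,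
`h = λ/(1 − δλ)` on `[δ+ε, ∞)`, and `0 ≤ h' ≤ h²` everywhere. -/
theorem escape_to_infinity_one_dim (lam δ ε : ℝ) (hlam : 0 < lam) (hδ : 0 < δ)
    (hδlam : δ < 1 / lam) (hε : 0 < ε) :
    ∃ h : ℝ → ℝ, ContDiff ℝ (⊤ : ℕ∞) h ∧ Monotone h ∧
      (∀ t : ℝ, lam ≤ h t ∧ h t ≤ lam / (1 - δ * lam)) ∧
      (∀ t : ℝ, t ≤ 0 → h t = lam) ∧
      (∀ t : ℝ, δ + ε ≤ t → h t = lam / (1 - δ * lam)) ∧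
      (∀ t : ℝ, 0 ≤ deriv h t ∧ deriv h t ≤ (h t) ^ 2) := by
  obtain ⟨φ, hφ, hφ', hφ0, hφ1⟩ :=
    exists_contDiff_transition_deriv_le_one hδ (lt_add_of_pos_right δ hε)
  have hdiff : Differentiable ℝ φ := hφ.differentiable (by simp)
  have hmono : Monotone φ := monotone_of_deriv_nonneg hdiff fun t => (hφ' t).1
  have hnonneg (t : ℝ) : 0 ≤ φ t :=
    (hφ0 _ (min_le_right t 0)).ge.trans (hmono (min_le_left t 0))
  have hle (t : ℝ) : φ t ≤ δ :=
    (hmono (le_max_left t (δ + ε))).trans (hφ1 _ (le_max_right t (δ + ε))).le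
  have hδlam' : 0 < 1 - δ * lam := sub_pos.2 ((lt_div_iff₀ hlam).1 hδlam)
  have hpos (t : ℝ) : 0 < 1 - φ t * lam :=
    hδlam'.trans_le (by gcongr; exact hle t)
  have hderiv (t : ℝ) : HasDerivAt (fun t => lam / (1 - φ t * lam))
      (deriv φ t * (lam / (1 - φ t * lam)) ^ 2) t := by
    refine ((hasDerivAt_const t lam).fun_div
      (((hdiff t).hasDerivAt.mul_const lam).const_sub 1) (hpos t).ne').congr_deriv ?_
    rw [div_pow]
    ring
  have hderiv_nonneg (t : ℝ) : 0 ≤ deriv φ t * (lam / (1 - φ t * lam)) ^ 2 :=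
    mul_nonneg (hφ' t).1 (sq_nonneg _)
  refine ⟨fun t => lam / (1 - φ t * lam), ?_, ?_, fun t => ⟨?_, ?_⟩, fun t ht => ?_,
    fun t ht => ?_, fun t => ?_⟩
  · exact contDiff_const.div (contDiff_const.sub (hφ.mul contDiff_const)) fun t => (hpos t).ne'
  · refine monotone_of_deriv_nonneg (fun t => (hderiv t).differentiableAt) fun t => ?_
    rw [(hderiv t).deriv]
    exact hderiv_nonneg t
  · exact le_div_self hlam.le (hpos t) (sub_le_self 1 (mul_nonneg (hnonneg t) hlam.le))
  · dsimp only
    gcongr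
    exact hle t
  · simp [hφ0 t ht]
  · simp [hφ1 t ht]
  · rw [(hderiv t).deriv]
    exact ⟨hderiv_nonneg t, mul_le_of_le_one_left (sq_nonneg _) (hφ' t).2⟩
end

section
/- Let n ≥ 1, let A and B be nonempty subsets of ℝⁿ with infDist-separation dist(A,B) := inf{‖a − b‖ : a ∈ A, b ∈ B} strictly greater than δ > 0, and let η > 0 satisfy η·δ < π/2. Then there exists a C^∞ function p : ℝⁿ → ℝ such that 0 ≤ p(x) ≤ η·tan(η·δ) for all x ∈ ℝⁿ, p vanishes on an open neighborhood of A, p equals η·tan(η·δ) on an open neighborhood of B, and the Fréchet derivative satisfies ‖fderiv p x‖ ≤ η² + p(x)² for every x ∈ ℝⁿ. -/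
open MeasureTheory Metric in
/-- A Lipschitz function on a finite-dimensional space can be mollified at scale `ε` without
increasing its Lipschitz constant. -/
theorem LipschitzWith.exists_contDiff_lipschitzWith {E F : Type*} [NormedAddCommGroup E]
    [NormedSpace ℝ E] [FiniteDimensional ℝ E] [NormedAddCommGroup F] [NormedSpace ℝ F]
    [CompleteSpace F] {f : E → F} {K : NNReal} {ε : ℝ} (hf : LipschitzWith K f) (hε : 0 < ε) :
    ∃ g : E → F, ContDiff ℝ (⊤ : ℕ∞) g ∧ LipschitzWith K g ∧
      ∀ a z r, (∀ x ∈ ball a ε, dist (f x) z ≤ r) → dist (g a) z ≤ r := by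
  borelize E
  let μ : Measure E := .addHaar
  let φ : ContDiffBump (0 : E) := ⟨ε / 2, ε, half_pos hε, half_lt_self hε⟩
  have hint (x : E) : Integrable (fun t ↦ φ.normed μ t • f (x - t)) μ :=
    ((φ.continuous_normed (μ := μ)).smul
      (hf.continuous.comp (continuous_const.sub continuous_id))).integrable_of_hasCompactSupport
      φ.hasCompactSupport_normed.smul_right
  refine ⟨convolution (φ.normed μ) f (ContinuousLinearMap.lsmul ℝ ℝ) μ,
    φ.hasCompactSupport_normed.contDiff_convolution_left _ φ.contDiff_normed
      (hf.continuous.locallyIntegrable (μ := μ)), ?_, ?_⟩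
  · refine LipschitzWith.of_dist_le_mul fun x y ↦ ?_
    simp only [convolution_def, ContinuousLinearMap.lsmul_apply]
    rw [dist_eq_norm, ← integral_sub (hint x) (hint y)]
    calc ‖∫ t, φ.normed μ t • f (x - t) - φ.normed μ t • f (y - t) ∂μ‖
        ≤ ∫ t, φ.normed μ t * (K * dist x y) ∂μ := by
          refine norm_integral_le_of_norm_le (φ.integrable_normed.mul_const _) (.of_forall fun t ↦ ?_)
          rw [← smul_sub, norm_smul, Real.norm_of_nonneg (φ.nonneg_normed t), ← dist_eq_norm]
          refine mul_le_mul_of_nonneg_left ?_ (φ.nonneg_normed t)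
          simpa using hf.dist_le_mul (x - t) (y - t)
      _ = K * dist x y := by rw [integral_mul_const, φ.integral_normed, one_mul]
  · intro a z r h
    exact dist_convolution_le (dist_nonneg.trans (h a (mem_ball_self hε)))
      φ.support_normed_eq.subset φ.nonneg_normed φ.integral_normed
      hf.continuous.aestronglyMeasurable h

open Metric in
/-- Two sets at distance greater than `δ` are separated by a smooth `1`-Lipschitz function with
values in `[0, δ]`, equal to `0` near the first set and to `δ` near the second. -/
theorem exists_contDiff_lipschitzWith_one_separating {E : Type*} [NormedAddCommGroup E]
    [NormedSpace ℝ E] [FiniteDimensional ℝ E] {A B : Set E} (hA : A.Nonempty) {δ : ℝ}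
    (hδ : 0 ≤ δ) (hsep : δ < sInf (Set.image2 dist A B)) :
    ∃ g : E → ℝ, ContDiff ℝ (⊤ : ℕ∞) g ∧ LipschitzWith 1 g ∧ (∀ x, g x ∈ Set.Icc 0 δ) ∧
      (∃ U, IsOpen U ∧ A ⊆ U ∧ ∀ x ∈ U, g x = 0) ∧
      ∃ V, IsOpen V ∧ B ⊆ V ∧ ∀ x ∈ V, g x = δ := by
  set s := sInf (Set.image2 dist A B)
  obtain ⟨ε, hε, hεs⟩ : ∃ ε, 0 < ε ∧ δ + 4 * ε = s := ⟨(s - δ) / 4, by linarith, by ring⟩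
  let f : E → ℝ := fun x ↦ max 0 (min δ (infDist x A - 2 * ε))
  have hf : LipschitzWith 1 f := by
    have h : LipschitzWith 1 fun x : E ↦ infDist x A - 2 * ε :=
      .of_le_add fun x y ↦ by linarith [infDist_le_infDist_add_dist (s := A) (x := x) (y := y)]
    exact (h.const_min δ).const_max 0
  have hf0 {x : E} (hx : infDist x A ≤ 2 * ε) : f x = 0 :=
    max_eq_left ((min_le_right _ _).trans (by linarith))
  have hfδ {x : E} (hx : δ + 2 * ε ≤ infDist x A) : f x = δ := by
    simp only [f]
    rw [min_eq_left (by linarith), max_eq_right hδ]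
  have hsB {b : E} (hb : b ∈ B) : s ≤ infDist b A := by
    refine (le_infDist hA).2 fun {a} ha ↦ ?_
    rw [dist_comm]
    exact csInf_le ⟨0, by rintro _ ⟨_, _, _, _, rfl⟩; exact dist_nonneg⟩
      (Set.mem_image2_of_mem ha hb)
  obtain ⟨g, hg, hgL, hgf⟩ := hf.exists_contDiff_lipschitzWith hε
  have hdist {x y : E} (h : y ∈ ball x ε) :
      infDist y A ≤ infDist x A + ε ∧ infDist x A ≤ infDist y A + ε := by
    have hd := mem_ball.1 h
    have h₁ := infDist_le_infDist_add_dist (s := A) (x := y) (y := x)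
    have h₂ := infDist_le_infDist_add_dist (s := A) (x := x) (y := y)
    rw [dist_comm] at h₂
    constructor <;> linarith
  refine ⟨g, hg, hgL, fun x ↦ ?_,
    ⟨{x | infDist x A < ε}, isOpen_lt (continuous_infDist_pt A) continuous_const,
      fun a ha ↦ ?_, fun x hx ↦ ?_⟩,
    ⟨{x | s - ε < infDist x A}, isOpen_lt continuous_const (continuous_infDist_pt A),
      fun b hb ↦ ?_, fun x hx ↦ ?_⟩⟩
  · have h := hgf x (δ / 2) (δ / 2) fun y _ ↦ by
      have h₀ : 0 ≤ f y := le_max_left _ _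
      have h₁ : f y ≤ δ := max_le hδ (min_le_left _ _)
      rw [Real.dist_eq, abs_le]
      constructor <;> linarith
    rw [Real.dist_eq, abs_le] at h
    constructor <;> linarith
  · simpa [infDist_zero_of_mem ha] using hε
  · refine dist_le_zero.1 (hgf x 0 0 fun y hy ↦ ?_)
    have hx' : infDist x A < ε := hx
    rw [hf0 (by linarith [(hdist hy).1]), dist_self]
  · change s - ε < infDist b A
    linarith [hsB hb]
  · refine dist_le_zero.1 (hgf x δ 0 fun y hy ↦ ?_)
    have hx' : s - ε < infDist x A := hx
    rw [hfδ (by linarith [(hdist hy).2]), dist_self]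


/-- Euclidean version of Lemma 3.2: if `A, B ⊆ ℝⁿ` are nonempty with
separation `inf{‖a − b‖} > δ > 0` and `η > 0` satisfies `η·δ < π/2`,
then there is a smooth `p : ℝⁿ → ℝ` with values in `[0, η·tan(ηδ)]`,
vanishing near `A`, equal to `η·tan(ηδ)` near `B`, and with
`‖dp‖ ≤ η² + p²` everywhere. -/
theorem tangent_growth_euclidean (n : ℕ) (hn : 1 ≤ n)
    (A B : Set (EuclideanSpace ℝ (Fin n))) (hA : A.Nonempty) (hB : B.Nonempty)
    (δ η : ℝ) (hδ : 0 < δ) (hη : 0 < η) (hηδ : η * δ < Real.pi / 2)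
    (hsep : δ < sInf (Set.image2 dist A B)) :
    ∃ p : EuclideanSpace ℝ (Fin n) → ℝ, ContDiff ℝ (⊤ : ℕ∞) p ∧
      (∀ x, 0 ≤ p x ∧ p x ≤ η * Real.tan (η * δ)) ∧
      (∃ U : Set (EuclideanSpace ℝ (Fin n)), IsOpen U ∧ A ⊆ U ∧ ∀ x ∈ U, p x = 0) ∧
      (∃ V : Set (EuclideanSpace ℝ (Fin n)), IsOpen V ∧ B ⊆ V ∧
        ∀ x ∈ V, p x = η * Real.tan (η * δ)) ∧
      (∀ x, ‖fderiv ℝ p x‖ ≤ η ^ 2 + (p x) ^ 2) := by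
  obtain ⟨g, hg, hgL, hgI, ⟨U, hU, hAU, hgU⟩, V, hV, hBV, hgV⟩ :=
    exists_contDiff_lipschitzWith_one_separating hA hδ.le hsep
  have h0 (x) : 0 ≤ η * g x := mul_nonneg hη.le (hgI x).1
  have hle (x) : η * g x ≤ η * δ := mul_le_mul_of_nonneg_left (hgI x).2 hη.le
  have hcos (x) : Real.cos (η * g x) ≠ 0 :=
    (Real.cos_pos_of_mem_Ioo ⟨by linarith [h0 x, Real.pi_pos], (hle x).trans_lt hηδ⟩).ne'
  refine ⟨fun x ↦ η * Real.tan (η * g x), ?_, fun x ↦ ⟨?_, ?_⟩,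
    ⟨U, hU, hAU, fun x hx ↦ by simp [hgU x hx]⟩, ⟨V, hV, hBV, fun x hx ↦ by simp [hgV x hx]⟩,
    fun x ↦ ?_⟩
  · refine contDiff_const.mul (contDiff_iff_contDiffAt.2 fun x ↦ ?_)
    exact ContDiffAt.comp (g := Real.tan) x (Real.contDiffAt_tan.2 (hcos x))
      (contDiff_const.mul hg).contDiffAt
  · exact mul_nonneg hη.le
      (Real.tan_nonneg_of_nonneg_of_le_pi_div_two (h0 x) ((hle x).trans hηδ.le))
  · refine mul_le_mul_of_nonneg_left (Real.strictMonoOn_tan.monotoneOn ?_ ?_ (hle x)) hη.le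
    · exact ⟨by linarith [h0 x, Real.pi_pos], (hle x).trans_lt hηδ⟩
    · exact ⟨by linarith [h0 x, hle x, Real.pi_pos], hηδ⟩
  · have hgd : HasFDerivAt g (fderiv ℝ g x) x :=
      (hg.differentiable (by simp) x).hasFDerivAt
    have hpd := ((Real.hasDerivAt_tan (hcos x)).comp_hasFDerivAt x (hgd.const_mul η)).const_mul η
    have hcoef : 1 / Real.cos (η * g x) ^ 2 = 1 + Real.tan (η * g x) ^ 2 := by
      rw [← Real.inv_one_add_tan_sq (hcos x), one_div, inv_inv]
    have hnorm : ‖fderiv ℝ g x‖ ≤ 1 := by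
      simpa using norm_fderiv_le_of_lipschitz ℝ hgL (x₀ := x)
    have hfd : fderiv ℝ (fun x ↦ η * Real.tan (η * g x)) x =
        (η ^ 2 + (η * Real.tan (η * g x)) ^ 2) • fderiv ℝ g x := by
      refine hpd.fderiv.trans ?_
      rw [hcoef, smul_smul, smul_smul]
      congr 1
      ring
    have hnn : 0 ≤ η ^ 2 + (η * Real.tan (η * g x)) ^ 2 := by positivity
    rw [hfd, norm_smul, Real.norm_of_nonneg hnn]
    exact mul_le_of_le_one_right hnn hnorm
end

section
/- Let n ≥ 1, let δ > 0, and let A and B be nonempty subsets of ℝⁿ whose infDist-separation dist(A,B) := inf{‖a − b‖ : a ∈ A, b ∈ B} is strictly greater than δ. Then there exist ε > 0 and a C^∞ function x : ℝⁿ → ℝ which is 1-Lipschitz (i.e. |x(p) − x(q)| ≤ ‖p − q‖ for all p, q), equals −ε on an open neighborhood of A, and equals δ + ε on an open neighborhood of B. -/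
open MeasureTheory Metric
open scoped Convolution NNReal ContDiff

section

variable {E F : Type*} [NormedAddCommGroup E] [NormedSpace ℝ E] [HasContDiffBump E]
  [MeasurableSpace E] [BorelSpace E] [FiniteDimensional ℝ E]
  [NormedAddCommGroup F] [NormedSpace ℝ F]

theorem ContDiffBump.lipschitzWith_normed_convolution (φ : ContDiffBump (0 : E))
    (μ : Measure E) [μ.IsAddHaarMeasure] {K : ℝ≥0} {g : E → F} (hg : LipschitzWith K g) :
    LipschitzWith K (φ.normed μ ⋆[ContinuousLinearMap.lsmul ℝ ℝ, μ] g : E → F) := by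
  have hint (x : E) : Integrable (fun t ↦ φ.normed μ t • g (x - t)) μ :=
    (φ.continuous_normed.smul (hg.continuous.comp (continuous_const.sub continuous_id)))
      |>.integrable_of_hasCompactSupport φ.hasCompactSupport_normed.smul_right
  refine LipschitzWith.of_dist_le_mul fun p q ↦ ?_
  simp only [convolution_def, ContinuousLinearMap.lsmul_apply]
  rw [dist_eq_norm, ← integral_sub (hint p) (hint q)]
  calc ‖∫ t, φ.normed μ t • g (p - t) - φ.normed μ t • g (q - t) ∂μ‖
      ≤ ∫ t, φ.normed μ t * (K * dist p q) ∂μ := by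
        refine norm_integral_le_of_norm_le (φ.integrable_normed.mul_const _) (.of_forall fun t ↦ ?_)
        rw [← smul_sub, norm_smul, Real.norm_of_nonneg (φ.nonneg_normed t), ← dist_eq_norm]
        gcongr
        · exact φ.nonneg_normed t
        · simpa using hg.dist_le_mul (p - t) (q - t)
    _ = K * dist p q := by rw [integral_mul_const, φ.integral_normed, one_mul]

/-- Mollification at scale `r` preserves the Lipschitz constant, and preserves the value
at every point around which the function is constant on a ball of radius `r`. -/
theorem LipschitzWith.exists_contDiff_eq_of_constant_on_ball [CompleteSpace F] {K : ℝ≥0}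
    {g : E → F} (hg : LipschitzWith K g) {r : ℝ} (hr : 0 < r) :
    ∃ f : E → F, ContDiff ℝ ∞ f ∧ LipschitzWith K f ∧
      ∀ x, (∀ y ∈ ball x r, g y = g x) → f x = g x := by
  let φ : ContDiffBump (0 : E) := ⟨r / 2, r, half_pos hr, half_lt_self hr⟩
  let μ : Measure E := Measure.addHaar
  exact ⟨φ.normed μ ⋆[ContinuousLinearMap.lsmul ℝ ℝ, μ] g,
    φ.hasCompactSupport_normed.contDiff_convolution_left _ φ.contDiff_normed
      hg.continuous.locallyIntegrable,
    φ.lipschitzWith_normed_convolution μ hg, fun x hx ↦ φ.normed_convolution_eq_right hx⟩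

end

/-- Euclidean version of the smooth 1-Lipschitz separating function
(Cecchini–Zeidler, Lemma 7.2): if `A, B ⊆ ℝⁿ` are nonempty with separation
`inf{‖a − b‖} > δ > 0`, then there are `ε > 0` and a smooth 1-Lipschitz
function `x : ℝⁿ → ℝ` equal to `−ε` near `A` and to `δ + ε` near `B`. -/
theorem smooth_lipschitz_separating_function (n : ℕ) (hn : 1 ≤ n) (δ : ℝ) (hδ : 0 < δ)
    (A B : Set (EuclideanSpace ℝ (Fin n))) (hA : A.Nonempty) (hB : B.Nonempty)
    (hsep : δ < sInf (Set.image2 dist A B)) :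
    ∃ ε : ℝ, 0 < ε ∧ ∃ f : EuclideanSpace ℝ (Fin n) → ℝ, ContDiff ℝ (⊤ : ℕ∞) f ∧
      (∀ p q : EuclideanSpace ℝ (Fin n), |f p - f q| ≤ ‖p - q‖) ∧
      (∃ U : Set (EuclideanSpace ℝ (Fin n)), IsOpen U ∧ A ⊆ U ∧ ∀ x ∈ U, f x = -ε) ∧
      (∃ V : Set (EuclideanSpace ℝ (Fin n)), IsOpen V ∧ B ⊆ V ∧ ∀ x ∈ V, f x = δ + ε) := by
  have hdist : ∀ a ∈ A, ∀ b ∈ B, sInf (Set.image2 dist A B) ≤ dist a b := fun a ha b hb ↦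
    csInf_le ⟨0, by rintro _ ⟨a, -, b, -, rfl⟩; exact dist_nonneg⟩ (Set.mem_image2_of_mem ha hb)
  obtain ⟨ε, hε⟩ : ∃ ε, ε = (sInf (Set.image2 dist A B) - δ) / 6 := ⟨_, rfl⟩
  have hε0 : 0 < ε := by linarith
  let g : EuclideanSpace ℝ (Fin n) → ℝ := fun p ↦ max (min (infDist p A - 3 * ε) (δ + ε)) (-ε)
  have hg : LipschitzWith 1 g := by
    refine LipschitzWith.max_const (LipschitzWith.min_const ?_ _) _
    exact LipschitzWith.of_dist_le_mul fun p q ↦ by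
      simpa using (lipschitz_infDist_pt A).dist_le_mul p q
  have hgA {x} (hx : x ∈ thickening (ε + ε) A) : g x = -ε := by
    have := (mem_thickening_iff_infDist_lt hA).1 hx
    exact max_eq_right ((min_le_left _ _).trans (by linarith))
  have hgB {x} (hx : x ∈ thickening (ε + ε) B) : g x = δ + ε := by
    obtain ⟨b, hb, hxb⟩ := mem_thickening_iff.1 hx
    have : δ + 4 * ε ≤ infDist x A := (le_infDist hA).2 fun a ha ↦ by
      linarith [hdist a ha b hb, dist_triangle a x b, dist_comm a x]
    simp only [g]
    rw [min_eq_right (by linarith), max_eq_left (by linarith)]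
  have hball {S : Set (EuclideanSpace ℝ (Fin n))} {x y} (hx : x ∈ thickening ε S)
      (hy : y ∈ ball x ε) : y ∈ thickening (ε + ε) S :=
    thickening_thickening_subset ε ε S (mem_thickening_iff.2 ⟨x, hx, hy⟩)
  obtain ⟨f, hf, hfL, hfg⟩ := hg.exists_contDiff_eq_of_constant_on_ball hε0
  refine ⟨ε, hε0, f, hf, fun p q ↦ ?_,
    ⟨thickening ε A, isOpen_thickening, self_subset_thickening hε0 A, fun x hx ↦ ?_⟩,
    ⟨thickening ε B, isOpen_thickening, self_subset_thickening hε0 B, fun x hx ↦ ?_⟩⟩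
  · simpa [Real.dist_eq, dist_eq_norm] using hfL.dist_le_mul p q
  · have hgx := hgA (hball hx (mem_ball_self hε0))
    rw [hfg x fun y hy ↦ (hgA (hball hx hy)).trans hgx.symm, hgx]
  · have hgx := hgB (hball hx (mem_ball_self hε0))
    rw [hfg x fun y hy ↦ (hgB (hball hx hy)).trans hgx.symm, hgx]
end

section
/- Let n ≥ 3 and let δ < 0. Then there exists a constant C > 0 such that for every C^∞ compactly supported function u : ℝⁿ → ℝ one has ∫_{ℝⁿ} u(x)² ρ(x)^{−2δ−n} dx ≤ C · ∫_{ℝⁿ} ‖∇u(x)‖² ρ(x)^{−2δ+2−n} dx, where ρ(x) = (1 + ‖x‖²)^{1/2}. -/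
open MeasureTheory

/-- Integration by parts against the Euler vector field: `∫ ∂ᵣg = -n ∫ g`. -/
theorem integral_fderiv_apply_self {n : ℕ} {g : EuclideanSpace ℝ (Fin n) → ℝ}
    (hg : ContDiff ℝ 1 g) (hc : HasCompactSupport g) :
    ∫ x, fderiv ℝ g x x = -((n : ℝ) * ∫ x, g x) := by
  have hdc : Continuous (fderiv ℝ g) := hg.continuous_fderiv one_ne_zero
  let e : Fin n → EuclideanSpace ℝ (Fin n) := fun i => EuclideanSpace.single i 1
  let p : Fin n → EuclideanSpace ℝ (Fin n) →L[ℝ] ℝ := fun i => EuclideanSpace.proj i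
  have hpe : ∀ i, p i (e i) = 1 := fun i => by simp [p, e]
  have hexp : ∀ x, fderiv ℝ g x x = ∑ i, p i x * fderiv ℝ g x (e i) := fun x => by
    conv_lhs => enter [2]; rw [← (EuclideanSpace.basisFun (Fin n) ℝ).sum_repr x]
    simp [p, e, EuclideanSpace.basisFun_apply]
  have hint : ∀ i, Integrable fun x => p i x * fderiv ℝ g x (e i) := fun i => by
    refine Continuous.integrable_of_hasCompactSupport (by fun_prop) ?_
    exact HasCompactSupport.mul_left (hc.fderiv_apply ℝ (e i))
  have hparts : ∀ i, ∫ x, p i x * fderiv ℝ g x (e i) = -∫ x, g x := fun i => by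
    have hgc := hg.continuous
    rw [integral_mul_fderiv_eq_neg_fderiv_mul_of_integrable _ (hint i) _
      (fun x _ => (p i).differentiableAt) (fun x _ => hg.differentiable one_ne_zero x)]
    · simp [hpe]
    · simpa [hpe] using hgc.integrable_of_hasCompactSupport hc
    · exact Continuous.integrable_of_hasCompactSupport (by fun_prop) hc.mul_left
  simp_rw [hexp]
  rw [integral_finsetSum _ fun i _ => hint i]
  simp [hparts]

theorem sqrt_rpow_eq_rpow_half {y : ℝ} (hy : 0 ≤ y) (r : ℝ) : Real.sqrt y ^ r = y ^ (r / 2) := by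
  rw [Real.sqrt_eq_rpow, ← Real.rpow_mul hy]
  ring_nf

/-- Derivative of the weight `(1 + ‖x‖²)ˢ`. -/
theorem hasFDerivAt_one_add_norm_sq_rpow {E : Type*} [NormedAddCommGroup E]
    [InnerProductSpace ℝ E] (s : ℝ) (x : E) :
    HasFDerivAt (fun z : E => (1 + ‖z‖ ^ 2) ^ s)
      ((s * (1 + ‖x‖ ^ 2) ^ (s - 1)) • ((2 : ℝ) • innerSL ℝ x)) x := by
  have h : HasFDerivAt (fun z : E => 1 + ‖z‖ ^ 2) ((2 : ℝ) • innerSL ℝ x) x := by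
    simpa [two_smul] using (hasStrictFDerivAt_norm_sq x).hasFDerivAt.const_add 1
  exact h.rpow_const (Or.inl (by positivity))

theorem contDiff_one_add_norm_sq_rpow {E : Type*} [NormedAddCommGroup E]
    [InnerProductSpace ℝ E] (s : ℝ) {k : WithTop ℕ∞} :
    ContDiff ℝ k fun z : E => (1 + ‖z‖ ^ 2) ^ s :=
  (contDiff_const.add (contDiff_norm_sq ℝ)).rpow_const_of_ne fun x => by positivity

/-- The pointwise bound behind the weighted Poincaré inequality: `v`, `d`, `D`, `t` stand for
`u x`, `∇u x · x`, `‖∇u x‖`, `‖x‖²`. -/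
theorem weighted_euler_pointwise_le {N s m v d D t : ℝ} (hm : 0 < m) (hmN : m ≤ N)
    (hms : m ≤ N + 2 * s) (ht : 0 ≤ t) (hd : d ^ 2 ≤ D ^ 2 * t) :
    m / 2 * (v ^ 2 * (1 + t) ^ s) - 2 / m * (D ^ 2 * (1 + t) ^ (s + 1)) ≤
      N * (v ^ 2 * (1 + t) ^ s) +
        (2 * v * d * (1 + t) ^ s + v ^ 2 * (s * (1 + t) ^ (s - 1) * (2 * t))) := by
  have hy : 0 < 1 + t := by positivity
  set w := (1 + t) ^ (s - 1) with hw
  have hw0 : 0 < w := Real.rpow_pos_of_pos hy _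
  have h1 : (1 + t) ^ s = w * (1 + t) := by
    rw [hw, ← Real.rpow_add_one hy.ne']; ring_nf
  have h2 : (1 + t) ^ (s + 1) = w * (1 + t) * (1 + t) := by
    rw [Real.rpow_add_one hy.ne', h1]
  rw [h1, h2]
  have hdiv : 0 ≤ v ^ 2 * (N * (1 + t) + 2 * s * t - m * (1 + t)) :=
    mul_nonneg (sq_nonneg v) (by nlinarith [mul_nonneg ht (sub_nonneg.2 hms)])
  have hD : d ^ 2 ≤ D ^ 2 * (1 + t) := by nlinarith [sq_nonneg D]
  have hyoung : 0 ≤ m / 2 * v ^ 2 + 2 * v * d + 2 / m * (D ^ 2 * (1 + t)) := by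
    have hsq : m / 2 * v ^ 2 + 2 * v * d + 2 / m * d ^ 2 = 2 / m * (m / 2 * v + d) ^ 2 := by
      field_simp; ring
    have : 0 ≤ 2 / m * (m / 2 * v + d) ^ 2 := by positivity
    have := mul_le_mul_of_nonneg_left hD (by positivity : 0 ≤ 2 / m)
    linarith
  have := mul_nonneg hw0.le hdiv
  have := mul_nonneg (mul_nonneg hw0.le hy.le) hyoung
  linarith

/-- Euclidean weighted Poincaré inequality (Proposition 2.5 of the paper):
for `n ≥ 3` and negative weight `δ`, there is `C > 0` such that for every
smooth compactly supported `u : ℝⁿ → ℝ`,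
`∫ u² ρ^(−2δ−n) ≤ C ∫ ‖∇u‖² ρ^(−2δ+2−n)` where `ρ(x) = (1 + ‖x‖²)^(1/2)`. -/
theorem weighted_poincare_euclidean (n : ℕ) (hn : 3 ≤ n) (δ : ℝ) (hδ : δ < 0) :
    ∃ C : ℝ, 0 < C ∧
      ∀ u : EuclideanSpace ℝ (Fin n) → ℝ, ContDiff ℝ (⊤ : ℕ∞) u → HasCompactSupport u →
        (∫ x : EuclideanSpace ℝ (Fin n),
            (u x) ^ 2 * (Real.sqrt (1 + ‖x‖ ^ 2)) ^ (-2 * δ - (n : ℝ))) ≤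
        C * ∫ x : EuclideanSpace ℝ (Fin n),
            ‖fderiv ℝ u x‖ ^ 2 * (Real.sqrt (1 + ‖x‖ ^ 2)) ^ (-2 * δ + 2 - (n : ℝ)) := by
  obtain ⟨m, hm, hmn, hmδ⟩ : ∃ m : ℝ, 0 < m ∧ m ≤ n ∧ m ≤ -2 * δ :=
    ⟨min n (-2 * δ), lt_min (by positivity) (by linarith), min_le_left _ _, min_le_right _ _⟩
  refine ⟨4 / m ^ 2, by positivity, fun u hu hc => ?_⟩
  set s : ℝ := (-2 * δ - n) / 2 with hs
  have hs' : (-2 * δ + 2 - (n : ℝ)) / 2 = s + 1 := by rw [hs]; ring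
  have hy : ∀ x : EuclideanSpace ℝ (Fin n), 0 ≤ 1 + ‖x‖ ^ 2 := fun x => by positivity
  simp_rw [sqrt_rpow_eq_rpow_half (hy _), hs', ← hs]
  have hu1 : ContDiff ℝ 1 u := hu.of_le (by exact_mod_cast le_top)
  have hwc : ∀ r : ℝ, Continuous fun x : EuclideanSpace ℝ (Fin n) => (1 + ‖x‖ ^ 2) ^ r :=
    fun r => (contDiff_one_add_norm_sq_rpow r (k := 0)).continuous
  have hdc : Continuous (fderiv ℝ u) := hu1.continuous_fderiv one_ne_zero
  have hcu2 : HasCompactSupport fun x => u x ^ 2 :=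
    hc.comp_left (g := fun v => v ^ 2) (by simp)
  set g : EuclideanSpace ℝ (Fin n) → ℝ := fun x => u x ^ 2 * (1 + ‖x‖ ^ 2) ^ s
  have hg : ContDiff ℝ 1 g := (hu1.pow 2).mul (contDiff_one_add_norm_sq_rpow s)
  have hgc : HasCompactSupport g := hcu2.mul_right
  have hgi : Integrable g := hg.continuous.integrable_of_hasCompactSupport hgc
  have hcD2 : HasCompactSupport fun x => ‖fderiv ℝ u x‖ ^ 2 :=
    (hc.fderiv ℝ).norm.comp_left (g := fun v : ℝ => v ^ 2) (by simp)
  have hDi : Integrable fun x => ‖fderiv ℝ u x‖ ^ 2 * (1 + ‖x‖ ^ 2) ^ (s + 1) :=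
    ((hdc.norm.pow 2).mul (hwc _)).integrable_of_hasCompactSupport hcD2.mul_right
  have hEi : Integrable fun x => fderiv ℝ g x x := by
    refine ((hg.continuous_fderiv one_ne_zero).clm_apply
      continuous_id).integrable_of_hasCompactSupport ((hgc.fderiv ℝ).mono fun x hx h => hx ?_)
    simp [h]
  have hder : ∀ x, fderiv ℝ g x x = 2 * u x * fderiv ℝ u x x * (1 + ‖x‖ ^ 2) ^ s +
      u x ^ 2 * (s * (1 + ‖x‖ ^ 2) ^ (s - 1) * (2 * ‖x‖ ^ 2)) := fun x => by
    have hux := (hu1.differentiable one_ne_zero x).hasFDerivAt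
    have h := (hux.pow 2).mul (hasFDerivAt_one_add_norm_sq_rpow s x)
    have h' : fderiv ℝ g x = _ := h.fderiv
    rw [h']
    simp
    ring
  have hle := integral_mono ((hgi.const_mul (m / 2)).sub (hDi.const_mul (2 / m)))
    ((hgi.const_mul (n : ℝ)).add hEi) fun x => by
      have := weighted_euler_pointwise_le (v := u x) (d := fderiv ℝ u x x)
        (D := ‖fderiv ℝ u x‖) (t := ‖x‖ ^ 2) (s := s) hm hmn (by rw [hs]; linarith)
        (by positivity) (by
          rw [← mul_pow, ← sq_abs]
          exact pow_le_pow_left₀ (abs_nonneg _) ((fderiv ℝ u x).le_opNorm x) 2)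
      simp only [Pi.add_apply, Pi.sub_apply, hder]
      exact this
  rw [integral_sub' (hgi.const_mul _) (hDi.const_mul _), integral_add' (hgi.const_mul _) hEi,
    integral_const_mul, integral_const_mul, integral_const_mul,
    integral_fderiv_apply_self hg hgc, add_neg_cancel, sub_nonpos] at hle
  have := mul_le_mul_of_nonneg_left hle (by positivity : 0 ≤ 2 / m)
  calc _ = 2 / m * (m / 2 * ∫ x, g x) := by field_simp
    _ ≤ _ := this
    _ = _ := by ring
end

section
/- Let n ≥ 3 and let δ < δ' be real numbers. Then every sequence (u_k) of C^∞ compactly supported functions u_k : ℝⁿ → ℝ satisfying ∫_{ℝⁿ} u_k(x)² ρ(x)^{−2δ−n} dx + ∫_{ℝⁿ} ‖∇u_k(x)‖² ρ(x)^{−2δ+2−n} dx ≤ 1 for all k admits a subsequence (u_{k_j}) which is Cauchy with respect to the norm u ↦ (∫_{ℝⁿ} u(x)² ρ(x)^{−2δ'−n} dx)^{1/2}, where ρ(x) = (1 + ‖x‖²)^{1/2}. -/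
open MeasureTheory

section WeightedSobolev

open Filter Topology Metric
open scoped ENNReal Asymptotics

theorem enorm_add_sq_le {F : Type*} [NormedAddCommGroup F] (a b : F) :
    ‖a + b‖ₑ ^ 2 ≤ 2 * (‖a‖ₑ ^ 2 + ‖b‖ₑ ^ 2) := by
  calc ‖a + b‖ₑ ^ 2 ≤ (‖a‖ₑ + ‖b‖ₑ) ^ 2 := by gcongr; exact enorm_add_le a b
    _ ≤ 2 * (‖a‖ₑ ^ 2 + ‖b‖ₑ ^ 2) := by
      simp only [enorm_eq_nnnorm]
      exact_mod_cast add_sq_le (a := ‖a‖₊) (b := ‖b‖₊)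

theorem enorm_sub_sq_le {F : Type*} [NormedAddCommGroup F] (a b : F) :
    ‖a - b‖ₑ ^ 2 ≤ 2 * (‖a‖ₑ ^ 2 + ‖b‖ₑ ^ 2) := by
  simpa [sub_eq_add_neg] using enorm_add_sq_le a (-b)

/-- Jensen's inequality for the squared norm, without integrability assumptions. -/
theorem enorm_integral_sq_le_lintegral {α F : Type*} [MeasurableSpace α] [NormedAddCommGroup F]
    [NormedSpace ℝ F] (ν : Measure α) [IsProbabilityMeasure ν] {f : α → F}
    (hf : AEStronglyMeasurable f ν) : ‖∫ x, f x ∂ν‖ₑ ^ 2 ≤ ∫⁻ x, ‖f x‖ₑ ^ 2 ∂ν := by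
  have h1 : ‖∫ x, f x ∂ν‖ₑ ≤ eLpNorm f 2 ν := by
    refine (enorm_integral_le_lintegral_enorm f).trans ?_
    rw [← eLpNorm_one_eq_lintegral_enorm]
    exact eLpNorm_le_eLpNorm_of_exponent_le (by norm_num) hf
  have h2 : eLpNorm f 2 ν ^ 2 = ∫⁻ x, ‖f x‖ₑ ^ 2 ∂ν := by
    have := eLpNorm_nnreal_pow_eq_lintegral (f := f) (μ := ν) (p := 2) (by norm_num)
    simpa using this
  rw [← h2]
  gcongr

section Translation

variable {E : Type*} [NormedAddCommGroup E] [NormedSpace ℝ E]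

theorem ContDiff.enorm_sub_translate_sq_le {w : E → ℝ} (hw : ContDiff ℝ 1 w) (x y : E) :
    ‖w x - w (x + y)‖ₑ ^ 2 ≤
      ‖y‖ₑ ^ 2 * ∫⁻ s in Set.Ioc (0 : ℝ) 1, ‖fderiv ℝ w (x + s • y)‖ₑ ^ 2 := by
  have hc : Continuous fun s : ℝ ↦ fderiv ℝ w (x + s • y) :=
    (hw.continuous_fderiv one_ne_zero).comp (by fun_prop)
  have hc' : Continuous fun s : ℝ ↦ fderiv ℝ w (x + s • y) y := hc.clm_apply continuous_const
  have hd : ∀ s ∈ Set.uIcc (0 : ℝ) 1,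
      HasDerivAt (fun s : ℝ ↦ w (x + s • y)) (fderiv ℝ w (x + s • y) y) s := by
    intro s _
    have h1 : HasDerivAt (fun s : ℝ ↦ x + s • y) y s := by
      simpa using ((hasDerivAt_id s).smul_const y).const_add x
    exact ((hw.differentiable one_ne_zero) (x + s • y)).hasFDerivAt.comp_hasDerivAt s h1
  have hint := intervalIntegral.integral_eq_sub_of_hasDerivAt hd (hc'.intervalIntegrable 0 1)
  rw [intervalIntegral.integral_of_le zero_le_one] at hint
  simp only [one_smul, zero_smul, add_zero] at hint
  have : IsProbabilityMeasure (volume.restrict (Set.Ioc (0 : ℝ) 1)) := ⟨by simp⟩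
  rw [enorm_sub_rev, ← hint]
  refine (enorm_integral_sq_le_lintegral _ hc'.aestronglyMeasurable).trans ?_
  rw [← lintegral_const_mul' _ _ (by finiteness)]
  refine lintegral_mono fun s ↦ ?_
  rw [← mul_pow, mul_comm]
  gcongr
  exact ContinuousLinearMap.le_opENorm _ _

variable [MeasurableSpace E] [BorelSpace E] [FiniteDimensional ℝ E]

theorem ContDiff.lintegral_ball_enorm_sub_translate_sq_le (μ : Measure E) [μ.IsAddHaarMeasure]
    {w : E → ℝ} (hw : ContDiff ℝ 1 w) (R : ℝ) {y : E} (hy : ‖y‖ ≤ 1) :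
    ∫⁻ x in ball 0 R, ‖w x - w (x + y)‖ₑ ^ 2 ∂μ ≤
      ‖y‖ₑ ^ 2 * ∫⁻ x in ball 0 (R + 1), ‖fderiv ℝ w x‖ₑ ^ 2 ∂μ := by
  have hc : Continuous (fderiv ℝ w) := hw.continuous_fderiv one_ne_zero
  calc ∫⁻ x in ball 0 R, ‖w x - w (x + y)‖ₑ ^ 2 ∂μ
      ≤ ∫⁻ x in ball 0 R, (‖y‖ₑ ^ 2 *
          ∫⁻ s in Set.Ioc (0 : ℝ) 1, ‖fderiv ℝ w (x + s • y)‖ₑ ^ 2) ∂μ :=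
        lintegral_mono fun x ↦ hw.enorm_sub_translate_sq_le x y
    _ = ‖y‖ₑ ^ 2 * ∫⁻ s in Set.Ioc (0 : ℝ) 1,
          ∫⁻ x in ball 0 R, ‖fderiv ℝ w (x + s • y)‖ₑ ^ 2 ∂μ := by
        rw [lintegral_const_mul' _ _ (by finiteness), lintegral_lintegral_swap]
        refine Continuous.aemeasurable ?_
        have : Continuous fun p : E × ℝ ↦ fderiv ℝ w (p.1 + p.2 • y) := hc.comp (by fun_prop)
        exact (ENNReal.continuous_pow 2).comp this.enorm
    _ ≤ ‖y‖ₑ ^ 2 * ∫⁻ _ in Set.Ioc (0 : ℝ) 1,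
          ∫⁻ x in ball 0 (R + 1), ‖fderiv ℝ w x‖ₑ ^ 2 ∂μ := by
        refine mul_le_mul' le_rfl ?_
        refine setLIntegral_mono measurable_const fun s hs ↦ ?_
        rw [← lintegral_indicator measurableSet_ball, ← lintegral_indicator measurableSet_ball,
          ← lintegral_add_right_eq_self ((ball (0 : E) (R + 1)).indicator _) (s • y)]
        refine lintegral_mono fun x ↦ ?_
        by_cases hx : x ∈ ball (0 : E) R
        · have hx' : x + s • y ∈ ball (0 : E) (R + 1) := by
            rw [mem_ball_zero_iff] at hx ⊢
            have h1 : ‖s • y‖ ≤ 1 := by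
              rw [norm_smul, Real.norm_of_nonneg hs.1.le]
              exact mul_le_one₀ hs.2 (norm_nonneg y) hy
            linarith [norm_add_le x (s • y)]
          simp [Set.indicator_of_mem hx, Set.indicator_of_mem hx']
        · simp [Set.indicator_of_notMem hx]
    _ = ‖y‖ₑ ^ 2 * ∫⁻ x in ball 0 (R + 1), ‖fderiv ℝ w x‖ₑ ^ 2 ∂μ := by simp

/-- Averaging a function over translations of length at most `t` changes it in `L²` of a ball by at
most `t` times the `L²` norm of its derivative on a slightly larger ball. -/
theorem ContDiff.lintegral_ball_enorm_sub_average_sq_le (μ : Measure E) [μ.IsAddHaarMeasure]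
    {w : E → ℝ} (hw : ContDiff ℝ 1 w) (hsupp : HasCompactSupport w) (R : ℝ) {t : ℝ} (ht : t ≤ 1)
    (ν : Measure E) [IsProbabilityMeasure ν] (hν : ∀ᵐ y ∂ν, ‖y‖ ≤ t) :
    ∫⁻ x in ball 0 R, ‖w x - ∫ y, w (x + y) ∂ν‖ₑ ^ 2 ∂μ ≤
      ENNReal.ofReal t ^ 2 * ∫⁻ x in ball 0 (R + 1), ‖fderiv ℝ w x‖ₑ ^ 2 ∂μ := by
  have hw0 := hw.continuous
  calc ∫⁻ x in ball 0 R, ‖w x - ∫ y, w (x + y) ∂ν‖ₑ ^ 2 ∂μ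
      ≤ ∫⁻ x in ball 0 R, ∫⁻ y, ‖w x - w (x + y)‖ₑ ^ 2 ∂ν ∂μ := by
        refine lintegral_mono fun x ↦ ?_
        have hi : Integrable (fun y ↦ w (x + y)) ν :=
          Continuous.integrable_of_hasCompactSupport (by fun_prop)
            (hsupp.comp_homeomorph (Homeomorph.addLeft x))
        have h1 : w x - ∫ y, w (x + y) ∂ν = ∫ y, (w x - w (x + y)) ∂ν := by
          rw [integral_sub (integrable_const _) hi]
          simp
        rw [h1]
        exact enorm_integral_sq_le_lintegral ν (Continuous.aestronglyMeasurable (by fun_prop))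
    _ = ∫⁻ y, ∫⁻ x in ball 0 R, ‖w x - w (x + y)‖ₑ ^ 2 ∂μ ∂ν := by
        rw [lintegral_lintegral_swap]
        refine Continuous.aemeasurable ?_
        have : Continuous fun p : E × E ↦ w p.1 - w (p.1 + p.2) := by fun_prop
        exact (ENNReal.continuous_pow 2).comp this.enorm
    _ ≤ ∫⁻ _, ENNReal.ofReal t ^ 2 * ∫⁻ x in ball 0 (R + 1), ‖fderiv ℝ w x‖ₑ ^ 2 ∂μ ∂ν := by
        refine lintegral_mono_ae ?_
        filter_upwards [hν] with y hy
        refine (hw.lintegral_ball_enorm_sub_translate_sq_le μ R (hy.trans ht)).trans ?_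
        gcongr
        rw [← ofReal_norm]
        exact ENNReal.ofReal_le_ofReal hy
    _ = _ := by simp

end Translation

/-- Bounded sequences in a separable Hilbert space have weakly convergent subsequences. -/
theorem exists_subseq_tendsto_inner {H : Type*} [NormedAddCommGroup H] [InnerProductSpace ℝ H]
    [CompleteSpace H] [TopologicalSpace.SeparableSpace H] (v : ℕ → H) {C : ℝ}
    (hv : ∀ k, ‖v k‖ ≤ C) :
    ∃ φ : ℕ → ℕ, StrictMono φ ∧
      ∀ h : H, ∃ l : ℝ, Tendsto (fun k ↦ inner ℝ (v (φ k)) h) atTop (𝓝 l) := by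
  obtain ⟨a, _, φ, hφ, hlim⟩ := WeakDual.isSeqCompact_closedBall ℝ H 0 C
    (x := fun k ↦ StrongDual.toWeakDual (InnerProductSpace.toDual ℝ H (v k)))
    (fun k ↦ by simpa using hv k)
  refine ⟨φ, hφ, fun h ↦ ⟨a h, ?_⟩⟩
  exact ((WeakDual.eval_continuous h).tendsto a).comp hlim

section Weighted

variable {E : Type*} [NormedAddCommGroup E] [NormedSpace ℝ E] [FiniteDimensional ℝ E]
  [MeasurableSpace E] [BorelSpace E]

theorem exists_lintegral_ball_enorm_sq_le (μ : Measure E) [μ.IsAddHaarMeasure] {p : E → ℝ}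
    (hp : Continuous p) (hpos : ∀ x, 0 < p x) (R : ℝ) (F : Type*) [NormedAddCommGroup F] :
    ∃ M : ℝ≥0∞, M ≠ ∞ ∧ ∀ (f : E → F), Continuous f →
      HasCompactSupport f → ∫ x, ‖f x‖ ^ 2 * p x ∂μ ≤ 1 →
        ∫⁻ x in ball 0 R, ‖f x‖ₑ ^ 2 ∂μ ≤ M := by
  obtain ⟨C, hC⟩ := (isCompact_closedBall (0 : E) R).exists_bound_of_continuousOn
    (hp.inv₀ fun x ↦ (hpos x).ne').continuousOn
  refine ⟨ENNReal.ofReal C, ENNReal.ofReal_ne_top, fun f hf hsupp hle ↦ ?_⟩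
  have hi : Integrable (fun x ↦ ‖f x‖ ^ 2 * p x) μ := by
    refine Continuous.integrable_of_hasCompactSupport (by fun_prop) ?_
    exact (hsupp.comp_left (g := fun a ↦ ‖a‖ ^ 2) (by simp)).mul_right
  calc ∫⁻ x in ball 0 R, ‖f x‖ₑ ^ 2 ∂μ
      ≤ ∫⁻ x in ball 0 R, ENNReal.ofReal C * ENNReal.ofReal (‖f x‖ ^ 2 * p x) ∂μ := by
        refine setLIntegral_mono (by fun_prop) fun x hx ↦ ?_
        have h1 := hC x (ball_subset_closedBall hx)
        rw [Pi.inv_apply, Real.norm_of_nonneg (inv_nonneg.2 (hpos x).le)] at h1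
        have hC0 : 0 ≤ C := (inv_nonneg.2 (hpos x).le).trans h1
        rw [← ofReal_norm, ← ENNReal.ofReal_pow (norm_nonneg _), ← ENNReal.ofReal_mul hC0]
        refine ENNReal.ofReal_le_ofReal ?_
        have h2 : 1 ≤ C * p x := (inv_le_iff_one_le_mul₀ (hpos x)).1 h1
        nlinarith [sq_nonneg ‖f x‖]
    _ ≤ ∫⁻ x, ENNReal.ofReal C * ENNReal.ofReal (‖f x‖ ^ 2 * p x) ∂μ :=
        setLIntegral_le_lintegral _ _
    _ = ENNReal.ofReal C * ENNReal.ofReal (∫ x, ‖f x‖ ^ 2 * p x ∂μ) := by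
        rw [lintegral_const_mul' _ _ ENNReal.ofReal_ne_top, ofReal_integral_eq_lintegral_ofReal hi]
        exact ae_of_all _ fun x ↦ mul_nonneg (sq_nonneg _) (hpos x).le
    _ ≤ ENNReal.ofReal C * 1 := by
        gcongr
        exact ENNReal.ofReal_le_one.2 hle
    _ = ENNReal.ofReal C := mul_one _

theorem exists_subseq_cauchySeq_setIntegral (μ : Measure E) [μ.IsAddHaarMeasure] {p : E → ℝ}
    (hp : Continuous p) (hpos : ∀ x, 0 < p x) {u : ℕ → E → ℝ} (hu : ∀ k, Continuous (u k))
    (hsupp : ∀ k, HasCompactSupport (u k)) (hbound : ∀ k, ∫ x, u k x ^ 2 * p x ∂μ ≤ 1) :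
    ∃ φ : ℕ → ℕ, StrictMono φ ∧
      ∀ K : Set E, IsCompact K → CauchySeq fun k ↦ ∫ x in K, u (φ k) x ∂μ := by
  have : Fact ((2 : ℝ≥0∞) ≠ ∞) := ⟨by norm_num⟩
  have hq : Continuous fun x ↦ √(p x) := hp.sqrt
  have hq0 : ∀ x, √(p x) ≠ 0 := fun x ↦ (Real.sqrt_pos.2 (hpos x)).ne'
  have hmem : ∀ k, MemLp (fun x ↦ u k x * √(p x)) 2 μ := fun k ↦
    Continuous.memLp_of_hasCompactSupport ((hu k).mul hq) (hsupp k).mul_right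
  have hnorm : ∀ k, ‖(hmem k).toLp‖ ≤ 1 := by
    intro k
    rw [← sq_le_one_iff₀ (norm_nonneg _), ← real_inner_self_eq_norm_sq, L2.inner_def]
    refine le_of_eq_of_le (integral_congr_ae ?_) (hbound k)
    filter_upwards [(hmem k).coeFn_toLp] with x hx
    rw [hx, real_inner_self_eq_norm_sq, Real.norm_eq_abs, sq_abs, mul_pow,
      Real.sq_sqrt (hpos x).le]
  obtain ⟨φ, hφ, hlim⟩ := exists_subseq_tendsto_inner (fun k ↦ (hmem k).toLp) hnorm
  refine ⟨φ, hφ, fun K hK ↦ ?_⟩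
  have hg : MemLp (K.indicator fun x ↦ (√(p x))⁻¹) 2 μ := by
    obtain ⟨C, hC⟩ := hK.exists_bound_of_continuousOn (hq.inv₀ hq0).continuousOn
    rw [memLp_indicator_iff_restrict hK.measurableSet]
    have : IsFiniteMeasure (μ.restrict K) := ⟨by simpa using hK.measure_lt_top⟩
    refine MemLp.of_bound (hq.inv₀ hq0).aestronglyMeasurable C ?_
    exact (ae_restrict_iff' hK.measurableSet).2 (ae_of_all _ hC)
  obtain ⟨l, hl⟩ := hlim hg.toLp
  refine Tendsto.cauchySeq (x := l) (hl.congr fun k ↦ ?_)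
  rw [L2.inner_def, ← integral_indicator hK.measurableSet]
  refine integral_congr_ae ?_
  filter_upwards [(hmem (φ k)).coeFn_toLp, hg.coeFn_toLp] with x hx hx'
  rw [hx, hx']
  by_cases hxK : x ∈ K
  · have := hq0 x
    simp [hxK]
    field_simp
  · simp [hxK]

/-- Local Rellich compactness: a sequence bounded in a weighted `H¹` norm has a subsequence that is
Cauchy in `L²` of every ball. -/
theorem exists_subseq_tendsto_lintegral_ball (μ : Measure E) [μ.IsAddHaarMeasure] {p q : E → ℝ}
    (hp : Continuous p) (hppos : ∀ x, 0 < p x) (hq : Continuous q) (hqpos : ∀ x, 0 < q x)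
    {u : ℕ → E → ℝ} (hu : ∀ k, ContDiff ℝ 1 (u k)) (hsupp : ∀ k, HasCompactSupport (u k))
    (hbound : ∀ k, ∫ x, u k x ^ 2 * p x ∂μ ≤ 1)
    (hbound' : ∀ k, ∫ x, ‖fderiv ℝ (u k) x‖ ^ 2 * q x ∂μ ≤ 1) :
    ∃ φ : ℕ → ℕ, StrictMono φ ∧ ∀ R : ℝ, Tendsto (fun jk : ℕ × ℕ ↦
      ∫⁻ x in ball 0 R, ‖u (φ jk.1) x - u (φ jk.2) x‖ₑ ^ 2 ∂μ) atTop (𝓝 0) := by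
  obtain ⟨φ, hφ, hcauchy⟩ := exists_subseq_cauchySeq_setIntegral μ hp hppos
    (fun k ↦ (hu k).continuous) hsupp hbound
  refine ⟨φ, hφ, fun R ↦ ?_⟩
  obtain ⟨M, hM, hMle⟩ := exists_lintegral_ball_enorm_sq_le μ hp hppos (R + 1) ℝ
  obtain ⟨M', hM', hMle'⟩ := exists_lintegral_ball_enorm_sq_le μ hq hqpos (R + 1) (E →L[ℝ] ℝ)
  have huM : ∀ k, ∫⁻ x in ball 0 (R + 1), ‖u k x‖ₑ ^ 2 ∂μ ≤ M := fun k ↦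
    hMle (u k) (hu k).continuous (hsupp k) (by simpa using hbound k)
  have huM' : ∀ k, ∫⁻ x in ball 0 (R + 1), ‖fderiv ℝ (u k) x‖ₑ ^ 2 ∂μ ≤ M' := fun k ↦
    hMle' _ ((hu k).continuous_fderiv one_ne_zero) ((hsupp k).fderiv ℝ) (hbound' k)
  have hdiff : ∀ j k, ∫⁻ x in ball 0 (R + 1), ‖fderiv ℝ (u j - u k) x‖ₑ ^ 2 ∂μ ≤ 4 * M' := by
    intro j k
    have hm : ∀ i, Measurable fun x ↦ ‖fderiv ℝ (u i) x‖ₑ ^ 2 := fun i ↦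
      (measurable_fderiv ℝ (u i)).enorm.pow_const 2
    calc ∫⁻ x in ball 0 (R + 1), ‖fderiv ℝ (u j - u k) x‖ₑ ^ 2 ∂μ
        ≤ ∫⁻ x in ball 0 (R + 1),
            2 * (‖fderiv ℝ (u j) x‖ₑ ^ 2 + ‖fderiv ℝ (u k) x‖ₑ ^ 2) ∂μ := by
          refine lintegral_mono fun x ↦ ?_
          rw [fderiv_sub ((hu j).differentiable one_ne_zero x)
            ((hu k).differentiable one_ne_zero x)]
          exact enorm_sub_sq_le _ _
      _ ≤ 2 * (M' + M') := by
          rw [lintegral_const_mul' _ _ (by norm_num), lintegral_add_left (hm j)]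
          exact mul_le_mul' le_rfl (add_le_add (huM' j) (huM' k))
      _ = 4 * M' := by ring
  rw [ENNReal.tendsto_nhds_zero]
  intro ε hε
  have hsmall : Tendsto (fun t : ℝ ↦ 2 * (ENNReal.ofReal t ^ 2 * (4 * M'))) (𝓝[>] 0) (𝓝 0) := by
    have hc : Continuous fun t : ℝ ↦ 2 * (ENNReal.ofReal t ^ 2 * (4 * M')) := by
      refine (ENNReal.continuous_const_mul (by norm_num)).comp ?_
      refine (ENNReal.continuous_mul_const (by finiteness)).comp ?_
      exact (ENNReal.continuous_pow 2).comp ENNReal.continuous_ofReal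
    have := (hc.tendsto 0).mono_left (nhdsWithin_le_nhds (s := Set.Ioi 0))
    simpa using this
  obtain ⟨t, htε, ht1, ht0⟩ : ∃ t : ℝ, 2 * (ENNReal.ofReal t ^ 2 * (4 * M')) ≤ ε / 2 ∧ t ≤ 1 ∧
      0 < t := by
    have h1 := ENNReal.tendsto_nhds_zero.1 hsmall (ε / 2) (ENNReal.half_pos hε.ne')
    have h2 : ∀ᶠ t : ℝ in 𝓝[>] 0, t ≤ 1 :=
      nhdsWithin_le_nhds (eventually_le_nhds zero_lt_one)
    exact (h1.and (h2.and self_mem_nhdsWithin)).exists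
  set B : Set E := closedBall 0 t with hB
  have hB0 : μ B ≠ 0 := (measure_closedBall_pos μ 0 ht0).ne'
  have hBtop : μ B ≠ ∞ := measure_closedBall_lt_top.ne
  set ν : Measure E := ProbabilityTheory.cond μ B with hν
  have hνprob : IsProbabilityMeasure ν :=
    ProbabilityTheory.cond_isProbabilityMeasure_of_finite hB0 hBtop
  have hνt : ∀ᵐ y ∂ν, ‖y‖ ≤ t := by
    filter_upwards [ProbabilityTheory.ae_cond_mem (μ := μ) measurableSet_closedBall] with y hy
    simpa [hB] using hy
  have hsub : ∀ j k x, ∫ y, (u j - u k) (x + y) ∂ν =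
      ∫ y, u j (x + y) ∂ν - ∫ y, u k (x + y) ∂ν := by
    intro j k x
    have hi : ∀ i, Integrable (fun y ↦ u i (x + y)) ν := fun i ↦
      Continuous.integrable_of_hasCompactSupport ((hu i).continuous.comp (by fun_prop))
        ((hsupp i).comp_homeomorph (Homeomorph.addLeft x))
    exact integral_sub (hi j) (hi k)
  have havg : ∀ x, CauchySeq fun k ↦ ∫ y, u (φ k) (x + y) ∂ν := by
    intro x
    have h1 : ∀ k, ∫ y, u (φ k) (x + y) ∂ν =
        (μ B)⁻¹.toReal • ∫ z in closedBall x t, u (φ k) z ∂μ := by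
      intro k
      rw [hν, ProbabilityTheory.cond, integral_smul_measure,
        ← integral_indicator measurableSet_closedBall,
        ← integral_indicator measurableSet_closedBall,
        ← integral_add_left_eq_self ((closedBall x t).indicator _) x]
      congr 2
      ext y
      simp [Set.indicator]
    simp_rw [h1]
    have := (hcauchy _ (isCompact_closedBall x t))
    exact (uniformContinuous_const_smul _).comp_cauchySeq this
  have hbdd : ∀ k, ∀ x ∈ ball (0 : E) R, ‖∫ y, u k (x + y) ∂ν‖ₑ ^ 2 ≤ (μ B)⁻¹ * M := by
    intro k x hx
    have hcx : Continuous fun y ↦ u k (x + y) := (hu k).continuous.comp (by fun_prop)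
    refine (enorm_integral_sq_le_lintegral ν hcx.aestronglyMeasurable).trans ?_
    rw [hν, ProbabilityTheory.cond, lintegral_smul_measure, smul_eq_mul]
    refine mul_le_mul' le_rfl (le_trans ?_ (huM k))
    rw [← lintegral_indicator measurableSet_closedBall, ← lintegral_indicator measurableSet_ball,
      ← lintegral_add_left_eq_self ((ball (0 : E) (R + 1)).indicator _) x]
    refine lintegral_mono fun y ↦ ?_
    by_cases hy : y ∈ closedBall (0 : E) t
    · have hy' : x + y ∈ ball (0 : E) (R + 1) := by
        have hy1 := mem_closedBall_zero_iff.1 hy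
        rw [mem_ball_zero_iff] at hx ⊢
        linarith [norm_add_le x y]
      simp [Set.indicator_of_mem hy, Set.indicator_of_mem hy']
    · simp [Set.indicator_of_notMem hy]
  have hmeas : ∀ k, Measurable fun x ↦ ∫ y, u k (x + y) ∂ν := by
    intro k
    have : Continuous fun z : E × E ↦ u k (z.1 + z.2) := (hu k).continuous.comp (by fun_prop)
    exact (StronglyMeasurable.integral_prod_right (f := fun x y ↦ u k (x + y))
      this.stronglyMeasurable).measurable
  have havg0 : Tendsto (fun jk : ℕ × ℕ ↦ ∫⁻ x in ball 0 R,
      ‖∫ y, (u (φ jk.1) - u (φ jk.2)) (x + y) ∂ν‖ₑ ^ 2 ∂μ) atTop (𝓝 0) := by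
    simp_rw [hsub]
    rw [← lintegral_zero (μ := μ.restrict (ball (0 : E) R))]
    refine tendsto_lintegral_filter_of_dominated_convergence
      (fun _ ↦ 4 * ((μ B)⁻¹ * M)) ?_ ?_ ?_ ?_
    · exact Eventually.of_forall fun jk ↦
        ((hmeas (φ jk.1)).sub (hmeas (φ jk.2))).enorm.pow_const 2
    · refine Eventually.of_forall fun jk ↦ ?_
      filter_upwards [ae_restrict_mem measurableSet_ball] with x hx
      calc _ ≤ 2 * ((μ B)⁻¹ * M + (μ B)⁻¹ * M) :=
            (enorm_sub_sq_le _ _).trans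
              (mul_le_mul' le_rfl (add_le_add (hbdd _ x hx) (hbdd _ x hx)))
        _ = 4 * ((μ B)⁻¹ * M) := by ring
    · rw [lintegral_const, Measure.restrict_apply_univ]
      have : μ (ball (0 : E) R) ≠ ∞ := measure_ball_lt_top.ne
      have : (μ B)⁻¹ ≠ ∞ := ENNReal.inv_ne_top.2 hB0
      finiteness
    · refine ae_of_all _ fun x ↦ ?_
      have h1 := cauchySeq_iff_tendsto_dist_atTop_0.1 (havg x)
      have h2 := ((ENNReal.continuous_pow 2).comp ENNReal.continuous_ofReal).tendsto 0
      simpa [Function.comp_def, ← edist_dist, edist_eq_enorm_sub] using h2.comp h1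
  have hε4 : 0 < ε / 4 := ENNReal.div_pos hε.ne' (by norm_num)
  filter_upwards [ENNReal.tendsto_nhds_zero.1 havg0 (ε / 4) hε4] with jk hjk
  set w : E → ℝ := u (φ jk.1) - u (φ jk.2) with hw
  have hw1 : ContDiff ℝ 1 w := (hu _).sub (hu _)
  have hws : HasCompactSupport w := (hsupp _).sub (hsupp _)
  have hwA : Measurable fun x ↦ ‖∫ y, w (x + y) ∂ν‖ₑ ^ 2 := by
    simp_rw [hw, hsub]
    exact ((hmeas (φ jk.1)).sub (hmeas (φ jk.2))).enorm.pow_const 2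
  calc ∫⁻ x in ball 0 R, ‖w x‖ₑ ^ 2 ∂μ
      ≤ ∫⁻ x in ball 0 R,
          2 * (‖w x - ∫ y, w (x + y) ∂ν‖ₑ ^ 2 + ‖∫ y, w (x + y) ∂ν‖ₑ ^ 2) ∂μ := by
        refine lintegral_mono fun x ↦ ?_
        simpa using enorm_add_sq_le (w x - ∫ y, w (x + y) ∂ν) (∫ y, w (x + y) ∂ν)
    _ = 2 * (∫⁻ x in ball 0 R, ‖w x - ∫ y, w (x + y) ∂ν‖ₑ ^ 2 ∂μ) +
          2 * ∫⁻ x in ball 0 R, ‖∫ y, w (x + y) ∂ν‖ₑ ^ 2 ∂μ := by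
        rw [lintegral_const_mul' _ _ (by norm_num), lintegral_add_right _ hwA, mul_add]
    _ ≤ 2 * (ENNReal.ofReal t ^ 2 * (4 * M')) + 2 * (ε / 4) := by
        refine add_le_add (mul_le_mul' le_rfl ?_) (mul_le_mul' le_rfl hjk)
        refine (hw1.lintegral_ball_enorm_sub_average_sq_le μ hws R ht1 ν hνt).trans ?_
        exact mul_le_mul' le_rfl (hdiff _ _)
    _ ≤ ε / 2 + ε / 2 := by
        refine add_le_add htε (le_of_eq ?_)
        rw [show (4 : ℝ≥0∞) = 2 * 2 by norm_num, ← mul_div_assoc,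
          ENNReal.mul_div_mul_left _ _ (by norm_num) (by norm_num)]
    _ = ε := ENNReal.add_halves ε

/-- Weighted Rellich compactness: the embedding of weighted `H¹` into `L²` with weight `p'` is
compact if `p'` is negligible at infinity with respect to the weight `p` of the `L²` part. -/
theorem exists_subseq_tendsto_integral_of_isLittleO (μ : Measure E) [μ.IsAddHaarMeasure]
    {p p' q : E → ℝ} (hp : Continuous p) (hppos : ∀ x, 0 < p x) (hp' : Continuous p')
    (hp'pos : ∀ x, 0 < p' x) (hq : Continuous q) (hqpos : ∀ x, 0 < q x)
    (hpp' : p' =o[cocompact E] p) {u : ℕ → E → ℝ} (hu : ∀ k, ContDiff ℝ 1 (u k))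
    (hsupp : ∀ k, HasCompactSupport (u k)) (hbound : ∀ k, ∫ x, u k x ^ 2 * p x ∂μ ≤ 1)
    (hbound' : ∀ k, ∫ x, ‖fderiv ℝ (u k) x‖ ^ 2 * q x ∂μ ≤ 1) :
    ∃ φ : ℕ → ℕ, StrictMono φ ∧ Tendsto (fun jk : ℕ × ℕ ↦
      ∫ x, (u (φ jk.1) x - u (φ jk.2) x) ^ 2 * p' x ∂μ) atTop (𝓝 0) := by
  obtain ⟨φ, hφ, hlim⟩ := exists_subseq_tendsto_lintegral_ball μ hp hppos hq hqpos hu hsupp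
    hbound hbound'
  refine ⟨φ, hφ, ?_⟩
  have hu0 : ∀ k, Continuous (u k) := fun k ↦ (hu k).continuous
  have hnonneg : ∀ jk : ℕ × ℕ, 0 ≤ ∫ x, (u (φ jk.1) x - u (φ jk.2) x) ^ 2 * p' x ∂μ := fun jk ↦
    integral_nonneg fun x ↦ mul_nonneg (sq_nonneg _) (hp'pos x).le
  refine tendsto_order.2 ⟨fun a ha ↦ Eventually.of_forall fun jk ↦ ha.trans_le (hnonneg jk),
    fun ε hε ↦ ?_⟩
  obtain ⟨R, hR⟩ : ∃ R : ℝ, ∀ x ∉ ball (0 : E) R, p' x ≤ ε / 8 * p x := by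
    have h1 := hpp'.def (c := ε / 8) (by positivity)
    obtain ⟨K, hK, hsub⟩ := mem_cocompact.1 h1
    obtain ⟨R, hR⟩ := hK.isBounded.subset_ball 0
    refine ⟨R, fun x hx ↦ ?_⟩
    have := hsub fun hxK ↦ hx (hR hxK)
    simpa [abs_of_pos (hppos x), abs_of_pos (hp'pos x)] using this
  obtain ⟨C, hC⟩ := (isCompact_closedBall (0 : E) R).exists_bound_of_continuousOn hp'.continuousOn
  have hlimR : Tendsto (fun jk : ℕ × ℕ ↦
      C * ∫ x in ball 0 R, (u (φ jk.1) x - u (φ jk.2) x) ^ 2 ∂μ) atTop (𝓝 0) := by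
    have h1 := ((ENNReal.tendsto_toReal ENNReal.zero_ne_top).comp (hlim R)).const_mul C
    simp only [ENNReal.toReal_zero, mul_zero] at h1
    refine h1.congr fun jk ↦ ?_
    have hc : Continuous fun x ↦ (u (φ jk.1) x - u (φ jk.2) x) ^ 2 :=
      ((hu0 _).sub (hu0 _)).pow 2
    rw [integral_eq_lintegral_of_nonneg_ae (ae_of_all _ fun x ↦ sq_nonneg _)
      hc.aestronglyMeasurable]
    refine congrArg (fun r : ℝ≥0∞ ↦ C * r.toReal) (lintegral_congr fun x ↦ ?_)
    rw [← ofReal_norm, ← ENNReal.ofReal_pow (norm_nonneg _), Real.norm_eq_abs, sq_abs]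
  filter_upwards [(tendsto_order.1 hlimR).2 (ε / 2) (half_pos hε)] with jk hjk
  set a := u (φ jk.1)
  set b := u (φ jk.2)
  have hab : Continuous fun x ↦ a x - b x := (hu0 _).sub (hu0 _)
  have habs : HasCompactSupport fun x ↦ a x - b x := (hsupp _).sub (hsupp _)
  have hsq : ∀ {f r : E → ℝ}, Continuous f → HasCompactSupport f → Continuous r →
      Integrable (fun x ↦ f x ^ 2 * r x) μ := fun hf hfs hr ↦
    Continuous.integrable_of_hasCompactSupport ((hf.pow 2).mul hr)
      (hfs.comp_left (g := fun y : ℝ ↦ y ^ 2) (by simp)).mul_right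
  have hia := hsq (hu0 (φ jk.1)) (hsupp _) hp
  have hib := hsq (hu0 (φ jk.2)) (hsupp _) hp
  have hid : Integrable (fun x ↦ (a x - b x) ^ 2) μ := by
    simpa using hsq hab habs (continuous_const (y := (1 : ℝ)))
  have hidB : Integrable ((ball (0 : E) R).indicator fun x ↦ (a x - b x) ^ 2) μ :=
    hid.indicator measurableSet_ball
  calc ∫ x, (a x - b x) ^ 2 * p' x ∂μ
      ≤ ∫ x, (C * (ball (0 : E) R).indicator (fun x ↦ (a x - b x) ^ 2) x +
          ε / 4 * (a x ^ 2 * p x + b x ^ 2 * p x)) ∂μ := by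
        refine integral_mono (hsq hab habs hp')
          ((hidB.const_mul C).add ((hia.add hib).const_mul (ε / 4))) fun x ↦ ?_
        have h0 : 0 ≤ ε / 4 * (a x ^ 2 * p x + b x ^ 2 * p x) := by
          have := hppos x
          positivity
        by_cases hx : x ∈ ball (0 : E) R
        · have h1 := hC x (ball_subset_closedBall hx)
          rw [Real.norm_of_nonneg (hp'pos x).le] at h1
          simp only [Set.indicator_of_mem hx]
          nlinarith [sq_nonneg (a x - b x)]
        · simp only [Set.indicator_of_notMem hx, mul_zero, zero_add]
          calc (a x - b x) ^ 2 * p' x ≤ (2 * (a x ^ 2 + b x ^ 2)) * (ε / 8 * p x) := by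
                gcongr
                · exact (hp'pos x).le
                · nlinarith [sq_nonneg (a x + b x)]
                · exact hR x hx
            _ = ε / 4 * (a x ^ 2 * p x + b x ^ 2 * p x) := by ring
    _ = C * ∫ x in ball 0 R, (a x - b x) ^ 2 ∂μ +
          ε / 4 * (∫ x, a x ^ 2 * p x ∂μ + ∫ x, b x ^ 2 * p x ∂μ) := by
        have hiab : Integrable (fun x ↦ a x ^ 2 * p x + b x ^ 2 * p x) μ := hia.add hib
        rw [integral_add (hidB.const_mul C) (hiab.const_mul (ε / 4)),
          integral_const_mul, integral_const_mul, integral_add hia hib,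
          integral_indicator measurableSet_ball]
    _ < ε / 2 + ε / 4 * (1 + 1) := by
        refine add_lt_add_of_lt_of_le hjk ?_
        gcongr
        · exact hbound _
        · exact hbound _
    _ = ε := by ring

end Weighted

theorem isLittleO_rpow_sqrt_one_add_norm_sq {E : Type*} [NormedAddCommGroup E] [ProperSpace E]
    {a b : ℝ} (hab : a < b) :
    (fun x : E ↦ √(1 + ‖x‖ ^ 2) ^ a) =o[cocompact E] fun x ↦ √(1 + ‖x‖ ^ 2) ^ b := by
  have hpos : ∀ x : E, 0 < √(1 + ‖x‖ ^ 2) := fun x ↦ by positivity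
  have h1 : Tendsto (fun x : E ↦ √(1 + ‖x‖ ^ 2)) (cocompact E) atTop := by
    refine tendsto_atTop_mono (fun x ↦ ?_) (tendsto_norm_cocompact_atTop (E := E))
    exact Real.le_sqrt_of_sq_le (by linarith)
  refine Asymptotics.isLittleO_of_tendsto (fun x hx ↦ ?_) ?_
  · exact absurd hx (Real.rpow_pos_of_pos (hpos x) b).ne'
  · refine ((tendsto_rpow_neg_atTop (sub_pos.2 hab)).comp h1).congr fun x ↦ ?_
    rw [Function.comp_apply, neg_sub, Real.rpow_sub (hpos x)]

end WeightedSobolev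

/-- Euclidean weighted Rellich–Kondrachov theorem (Proposition 2.7 of the paper):
for `n ≥ 3` and weights `δ < δ'`, every sequence of smooth compactly supported
functions bounded by `1` in the weighted `H¹_δ`-norm admits a subsequence which is
Cauchy in the weighted `L²_{δ'}`-norm, where `ρ(x) = (1 + ‖x‖²)^(1/2)`. -/
theorem weighted_rellich_euclidean (n : ℕ) (hn : 3 ≤ n) (δ δ' : ℝ) (hδ : δ < δ')
    (u : ℕ → EuclideanSpace ℝ (Fin n) → ℝ)
    (hsmooth : ∀ k, ContDiff ℝ (⊤ : ℕ∞) (u k)) (hsupp : ∀ k, HasCompactSupport (u k))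
    (hbound : ∀ k,
      (∫ x : EuclideanSpace ℝ (Fin n),
          (u k x) ^ 2 * (Real.sqrt (1 + ‖x‖ ^ 2)) ^ (-2 * δ - (n : ℝ))) +
      (∫ x : EuclideanSpace ℝ (Fin n),
          ‖fderiv ℝ (u k) x‖ ^ 2 * (Real.sqrt (1 + ‖x‖ ^ 2)) ^ (-2 * δ + 2 - (n : ℝ))) ≤ 1) :
    ∃ φ : ℕ → ℕ, StrictMono φ ∧
      ∀ ε : ℝ, 0 < ε → ∃ N : ℕ, ∀ j ≥ N, ∀ k ≥ N,
        (∫ x : EuclideanSpace ℝ (Fin n),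
            (u (φ j) x - u (φ k) x) ^ 2 *
              (Real.sqrt (1 + ‖x‖ ^ 2)) ^ (-2 * δ' - (n : ℝ))) ^ (1/2 : ℝ) < ε := by
  have hpos : ∀ x : EuclideanSpace ℝ (Fin n), 0 < Real.sqrt (1 + ‖x‖ ^ 2) := fun x ↦ by positivity
  have hwpos : ∀ (a : ℝ) (x : EuclideanSpace ℝ (Fin n)), 0 < Real.sqrt (1 + ‖x‖ ^ 2) ^ a :=
    fun a x ↦ Real.rpow_pos_of_pos (hpos x) a
  have hwcont : ∀ a : ℝ,
      Continuous fun x : EuclideanSpace ℝ (Fin n) ↦ Real.sqrt (1 + ‖x‖ ^ 2) ^ a := fun a ↦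
    Continuous.rpow_const (by fun_prop) fun x ↦ Or.inl (hpos x).ne'
  have h1 : ∀ k, 0 ≤ ∫ x : EuclideanSpace ℝ (Fin n),
      (u k x) ^ 2 * (Real.sqrt (1 + ‖x‖ ^ 2)) ^ (-2 * δ - (n : ℝ)) := fun k ↦
    integral_nonneg fun x ↦ mul_nonneg (sq_nonneg _) (hwpos _ x).le
  have h2 : ∀ k, 0 ≤ ∫ x : EuclideanSpace ℝ (Fin n),
      ‖fderiv ℝ (u k) x‖ ^ 2 * (Real.sqrt (1 + ‖x‖ ^ 2)) ^ (-2 * δ + 2 - (n : ℝ)) := fun k ↦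
    integral_nonneg fun x ↦ mul_nonneg (sq_nonneg _) (hwpos _ x).le
  obtain ⟨φ, hφ, hlim⟩ := exists_subseq_tendsto_integral_of_isLittleO volume
    (hwcont (-2 * δ - n)) (hwpos _) (hwcont (-2 * δ' - n)) (hwpos _)
    (hwcont (-2 * δ + 2 - n)) (hwpos _) (isLittleO_rpow_sqrt_one_add_norm_sq (by linarith))
    (fun k ↦ (hsmooth k).of_le (by exact_mod_cast le_top)) hsupp
    (fun k ↦ by linarith [hbound k, h2 k]) (fun k ↦ by linarith [hbound k, h1 k])
  refine ⟨φ, hφ, fun ε hε ↦ ?_⟩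
  obtain ⟨⟨N₁, N₂⟩, hN⟩ := Filter.eventually_atTop.1
    ((tendsto_order.1 hlim).2 (ε ^ 2) (by positivity))
  refine ⟨max N₁ N₂, fun j hj k hk ↦ ?_⟩
  rw [← Real.sqrt_eq_rpow, Real.sqrt_lt' hε]
  exact hN (j, k) ⟨(le_max_left _ _).trans hj, (le_max_right _ _).trans hk⟩
end

section
/- Let η > 0 and d > 0 satisfy η·d < π/2, set λ = η·tan(η·d), let l satisfy 0 < l < 1/λ, and let ε > 0. Then there exists a C^∞ nondecreasing function ψ : ℝ → ℝ such that: 0 ≤ ψ(t) ≤ λ/(1 − l·λ) for all t; ψ(t) = 0 for all t ≤ 0; ψ(t) = λ/(1 − l·λ) for all t ≥ d + l + 2ε; deriv ψ t ≤ η² + ψ(t)² for all t ∈ ℝ; and deriv ψ t ≤ ψ(t)² for all t ≥ d + ε. -/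
/-- A smooth ramp: it climbs from `0` at `a` to `d` at `a + d + ε` with slope in `[0, 1]`. -/
theorem exists_smooth_ramp (a d ε : ℝ) (hd : 0 < d) (hε : 0 < ε) :
    ∃ g g' : ℝ → ℝ, ContDiff ℝ (⊤ : ℕ∞) g ∧ (∀ t, HasDerivAt g (g' t) t) ∧
      (∀ t, 0 ≤ g' t) ∧ (∀ t, g' t ≤ 1) ∧ (∀ t, 0 ≤ g t) ∧ (∀ t, g t ≤ d) ∧
      (∀ t, t ≤ a → g t = 0) ∧ (∀ t, t ≤ a → g' t = 0) ∧
      (∀ t, a + d + ε ≤ t → g t = d) ∧ (∀ t, a + d + ε ≤ t → g' t = 0) := by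
  let ρ : ContDiffBump (a + (d + ε) / 2 : ℝ) := ⟨d / 2, (d + ε) / 2, by linarith, by linarith⟩
  have hρc : Continuous ρ := ρ.continuous
  have hρi : ∀ u v, IntervalIntegrable ρ MeasureTheory.volume u v :=
    fun u v => hρc.intervalIntegrable u v
  have hleft : ∀ t, t ≤ a → ρ t = 0 := fun t ht => ρ.zero_of_le_dist (by
    rw [Real.dist_eq, abs_of_nonpos (by linarith)]
    change (d + ε) / 2 ≤ _
    linarith)
  have hright : ∀ t, a + d + ε ≤ t → ρ t = 0 := fun t ht => ρ.zero_of_le_dist (by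
    rw [Real.dist_eq, abs_of_nonneg (by linarith)]
    change (d + ε) / 2 ≤ _
    linarith)
  set I := ∫ x in a..(a + d + ε), ρ x with hI
  have hdI : d ≤ I := by
    have h1 : ∫ x in (a + ε / 2)..(a + ε / 2 + d), ρ x = d := by
      rw [intervalIntegral.integral_congr (g := fun _ => (1 : ℝ))]
      · simp
      · intro x hx
        rw [Set.uIcc_of_le (by linarith)] at hx
        refine ρ.one_of_mem_closedBall ?_
        rw [Metric.mem_closedBall, Real.dist_eq, abs_le]
        change -(d / 2) ≤ _ ∧ _ ≤ d / 2
        constructor <;> linarith [hx.1, hx.2]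
    rw [← h1]
    exact intervalIntegral.integral_mono_interval (by linarith) (by linarith) (by linarith)
      (Filter.Eventually.of_forall fun x => ρ.nonneg) (hρi _ _)
  have hIpos : 0 < I := hd.trans_le hdI
  have hderiv : ∀ t, HasDerivAt (fun t => d / I * ∫ x in a..t, ρ x) (d / I * ρ t) t := fun t =>
    (intervalIntegral.integral_hasDerivAt_right (hρi _ _)
      (hρc.stronglyMeasurableAtFilter _ _) hρc.continuousAt).const_mul _
  have hnonneg : ∀ t, 0 ≤ d / I * ρ t := fun t => mul_nonneg (by positivity) ρ.nonneg
  have hgleft : ∀ t, t ≤ a → d / I * ∫ x in a..t, ρ x = 0 := fun t ht => by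
    rw [intervalIntegral.integral_congr (g := fun _ => (0 : ℝ))]
    · simp
    · intro x hx
      rw [Set.uIcc_of_ge ht] at hx
      exact hleft x hx.2
  have hgright : ∀ t, a + d + ε ≤ t → d / I * ∫ x in a..t, ρ x = d := fun t ht => by
    rw [← intervalIntegral.integral_add_adjacent_intervals (hρi a (a + d + ε)) (hρi _ t),
      intervalIntegral.integral_congr (a := a + d + ε) (g := fun _ => (0 : ℝ)), ← hI]
    · simp [hIpos.ne']
    · intro x hx
      rw [Set.uIcc_of_le ht] at hx
      exact hright x hx.1
  have hmono : Monotone (fun t => d / I * ∫ x in a..t, ρ x) :=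
    monotone_of_deriv_nonneg (fun t => (hderiv t).differentiableAt)
      fun t => by rw [(hderiv t).deriv]; exact hnonneg t
  refine ⟨fun t => d / I * ∫ x in a..t, ρ x, fun t => d / I * ρ t, ?_, hderiv, hnonneg, ?_, ?_, ?_,
    hgleft, ?_, hgright, ?_⟩
  · rw [contDiff_infty_iff_deriv]
    refine ⟨fun t => (hderiv t).differentiableAt, ?_⟩
    rw [funext fun t => (hderiv t).deriv]
    exact contDiff_const.mul ρ.contDiff
  · exact fun t => mul_le_one₀ ((div_le_one hIpos).2 hdI) ρ.nonneg ρ.le_one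
  · exact fun t => (hgleft _ (min_le_right t a)).symm.le.trans (hmono (min_le_left t a))
  · exact fun t => (hmono (le_max_left t (a + d + ε))).trans (hgright _ (le_max_right _ _)).le
  · exact fun t ht => by simp [hleft t ht]
  · exact fun t ht => by simp [hright t ht]

/-- One-dimensional model of the glued potential `ψ` from the proof of Theorem C:
with `η·d < π/2`, `λ = η·tan(η·d)` and `0 < l < 1/λ`, there is a smooth
nondecreasing `ψ : ℝ → ℝ` with `0 ≤ ψ ≤ λ/(1 − lλ)`, `ψ = 0` for `t ≤ 0`,
`ψ = λ/(1 − lλ)` for `t ≥ d + l + 2ε`, `ψ' ≤ η² + ψ²` everywhere and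
`ψ' ≤ ψ²` for `t ≥ d + ε`. -/
theorem glued_potential_one_dim (η d l ε : ℝ) (hη : 0 < η) (hd : 0 < d)
    (hηd : η * d < Real.pi / 2) (hl : 0 < l)
    (hllam : l < 1 / (η * Real.tan (η * d))) (hε : 0 < ε) :
    ∃ ψ : ℝ → ℝ, ContDiff ℝ (⊤ : ℕ∞) ψ ∧ Monotone ψ ∧
      (∀ t : ℝ, 0 ≤ ψ t ∧
        ψ t ≤ η * Real.tan (η * d) / (1 - l * (η * Real.tan (η * d)))) ∧
      (∀ t : ℝ, t ≤ 0 → ψ t = 0) ∧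
      (∀ t : ℝ, d + l + 2 * ε ≤ t →
        ψ t = η * Real.tan (η * d) / (1 - l * (η * Real.tan (η * d)))) ∧
      (∀ t : ℝ, deriv ψ t ≤ η ^ 2 + (ψ t) ^ 2) ∧
      (∀ t : ℝ, d + ε ≤ t → deriv ψ t ≤ (ψ t) ^ 2) := by
  obtain ⟨g, g', hg, hgd, hg0, hg1, hgn, hgle, hgl, -, hgr, hgr'⟩ :=
    exists_smooth_ramp 0 d ε hd hε
  obtain ⟨k, k', hk, hkd, hk0, hk1, -, hkle, hkl, hkl', hkr, -⟩ :=
    exists_smooth_ramp (d + ε) l ε hl hε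
  simp only [zero_add] at hgr hgr'
  set L := η * Real.tan (η * d) with hL
  have hLpos : 0 < L := mul_pos hη (Real.tan_pos_of_pos_of_lt_pi_div_two (by positivity) hηd)
  have hlL : l * L < 1 := (lt_div_iff₀ hLpos).1 hllam
  have hηg : ∀ t, 0 ≤ η * g t := fun t => mul_nonneg hη.le (hgn t)
  have hηg' : ∀ t, η * g t ≤ η * d := fun t => mul_le_mul_of_nonneg_left (hgle t) hη.le
  have hcos : ∀ t, 0 < Real.cos (η * g t) := fun t =>
    Real.cos_pos_of_mem_Ioo ⟨by linarith [hηg t, Real.pi_pos], by linarith [hηg' t]⟩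
  let A : ℝ → ℝ := fun t => η * Real.tan (η * g t)
  have hA0 : ∀ t, 0 ≤ A t := fun t =>
    mul_nonneg hη.le (Real.tan_nonneg_of_nonneg_of_le_pi_div_two (hηg t) (by linarith [hηg' t]))
  have hAL : ∀ t, A t ≤ L := fun t => mul_le_mul_of_nonneg_left
    (Real.strictMonoOn_tan.monotoneOn ⟨by linarith [hηg t, Real.pi_pos], by linarith [hηg' t]⟩
      ⟨by linarith [hηg t, hηg' t, Real.pi_pos], hηd⟩ (hηg' t)) hη.le
  have hAr : ∀ t, d + ε ≤ t → A t = L := fun t ht => by simp only [A, hgr t ht, hL]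
  have hAsmooth : ContDiff ℝ (⊤ : ℕ∞) A := contDiff_iff_contDiffAt.2 fun t =>
    contDiffAt_const.mul (ContDiffAt.comp (g := Real.tan) (f := fun t => η * g t) t
      (Real.contDiffAt_tan.2 (hcos t).ne') (contDiffAt_const.mul hg.contDiffAt))
  have hAd : ∀ t, HasDerivAt A ((η ^ 2 + A t ^ 2) * g' t) t := fun t => by
    have hd := ((Real.hasDerivAt_tan (hcos t).ne').comp t ((hgd t).const_mul η)).const_mul η
    refine hd.congr_deriv ?_
    have hc := (hcos t).ne'
    simp only [A, Real.tan_eq_sin_div_cos]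
    field_simp
    linear_combination -g' t * Real.sin_sq_add_cos_sq (η * g t)
  have hden : ∀ t, 0 < 1 - k t * A t := fun t => by
    have := mul_le_mul (hkle t) (hAL t) (hA0 t) hl.le
    linarith
  have hψd : ∀ t, HasDerivAt (fun t => A t / (1 - k t * A t))
      (((η ^ 2 + A t ^ 2) * g' t + k' t * A t ^ 2) / (1 - k t * A t) ^ 2) t := fun t => by
    refine ((hAd t).div (((hkd t).mul (hAd t)).const_sub 1) (hden t).ne').congr_deriv ?_
    rw [Pi.mul_apply]
    ring
  have hψd0 : ∀ t, 0 ≤ ((η ^ 2 + A t ^ 2) * g' t + k' t * A t ^ 2) / (1 - k t * A t) ^ 2 :=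
    fun t => by
      have := hg0 t
      have := hk0 t
      positivity
  have hmono : Monotone (fun t => A t / (1 - k t * A t)) :=
    monotone_of_deriv_nonneg (fun t => (hψd t).differentiableAt)
      fun t => by rw [(hψd t).deriv]; exact hψd0 t
  have hr : ∀ t, d + l + 2 * ε ≤ t → A t / (1 - k t * A t) = L / (1 - l * L) := fun t ht => by
    rw [hAr t (by linarith), hkr t (by linarith)]
  have hlate : ∀ t, d + ε ≤ t →
      ((η ^ 2 + A t ^ 2) * g' t + k' t * A t ^ 2) / (1 - k t * A t) ^ 2
        ≤ (A t / (1 - k t * A t)) ^ 2 := fun t ht => by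
    rw [hgr' t ht, mul_zero, zero_add, div_pow]
    gcongr
    exact mul_le_of_le_one_left (sq_nonneg _) (hk1 t)
  refine ⟨fun t => A t / (1 - k t * A t), ?_, hmono, fun t => ⟨?_, ?_⟩, ?_, hr, ?_, ?_⟩
  · exact hAsmooth.div (contDiff_const.sub (hk.mul hAsmooth)) fun t => (hden t).ne'
  · exact div_nonneg (hA0 t) (hden t).le
  · exact (hmono (le_max_left t (d + l + 2 * ε))).trans (hr _ (le_max_right _ _)).le
  · exact fun t ht => by simp [A, hgl t ht]
  · intro t
    rw [(hψd t).deriv]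
    rcases le_total t (d + ε) with ht | ht
    · simpa [hkl t ht, hkl' t ht] using
        mul_le_of_le_one_right (by positivity : 0 ≤ η ^ 2 + A t ^ 2) (hg1 t)
    · exact (hlate t ht).trans (le_add_of_nonneg_left (sq_nonneg η))
  · intro t ht
    rw [(hψd t).deriv]
    exact hlate t ht
end
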